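/- Let X be a non-degenerate self-decomposable random vector in ℝ^d without Gaussian component, with characteristic function φ(ξ) = exp( i⟨b,ξ⟩ + ∫ (e^{i⟨ξ,u⟩} − 1 − i⟨ξ,u⟩1_{‖u‖≤1}) ν(du) ) and Lévy measure ν(du) = 1_{(0,∞)}(r)1_{S^{d−1}}(x)(k_x(r)/r) dr σ(dx), where σ is a finite positive measure on S^{d−1} and k_x(r) ≥ 0 is nonincreasing and continuous in r ∈ (0,∞), continuous in x ∈ S^{d−1}, with lim_{r→0⁺} r²k_x(r) = 0 and lim_{r→∞} k_x(r) = 0. Then: (i) for all ξ, x ∈ ℝ^d, lim_{t→0⁺} (1/t)( e^{i⟨x, ξ(e^{−t}−1)⟩} φ(ξ)/φ(e^{−t}ξ) − 1 ) = i⟨ b − ∫_{S^{d−1}} k_y(1) y σ(dy) − x , ξ ⟩ + ∫_{ℝ^d} ( e^{i⟨u,ξ⟩} − 1 − i⟨u,ξ⟩1_{‖u‖≤1} ) ν̃(du); (ii) for all ξ, x ∈ ℝ^d, sup_{t∈(0,1)} (1/t)| e^{i⟨x, ξ(e^{−t}−1)⟩} φ(ξ)/φ(e^{−t}ξ) − 1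 | ≤ (‖x‖ + ‖b‖)‖ξ‖ + ‖ξ‖² ∫_{S^{d−1}} (∫_0^1 s² τ_y(ds)) σ(dy) + 4∫_{S^{d−1}} k_y(1) σ(dy) + 2‖ξ‖² ∫_{S^{d−1}} k_y(1) σ(dy) + 2∫_{S^{d−1}} τ_y((1,∞)) σ(dy) + ‖ξ‖ ∫_{S^{d−1}} k_y(1) σ(dy), where τ_y is the Lebesgue–Stieltjes measure of −k_y and ν̃(du) = 1_{(0,∞)}(r)1_{S^{d−1}}(y)(−dk_y(r)) σ(dy). -/

import Mathlib

open MeasureTheory ProbabilityTheory Filter Set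
open scoped RealInnerProductSpace ENNReal NNReal Topology

noncomputable section

/-- The characteristic function of a measure on `ℝ^d`. -/
def charFn {d : ℕ} (μ : Measure (EuclideanSpace ℝ (Fin d)))
    (ξ : EuclideanSpace ℝ (Fin d)) : ℂ :=
  ∫ x, Complex.exp (Complex.I * (⟪ξ, x⟫ : ℂ)) ∂μ

/-- The Lévy–Khintchine exponent form of the characteristic function of a
self-decomposable law without Gaussian component. -/
def phiLK {d : ℕ} (b : EuclideanSpace ℝ (Fin d)) (ν : Measure (EuclideanSpace ℝ (Fin d)))
    (ξ : EuclideanSpace ℝ (Fin d)) : ℂ :=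
  Complex.exp (Complex.I * ((⟪b, ξ⟫ : ℝ) : ℂ)
    + ∫ u, (Complex.exp (Complex.I * ((⟪ξ, u⟫ : ℝ) : ℂ)) - 1
        - (if ‖u‖ ≤ 1 then Complex.I * ((⟪ξ, u⟫ : ℝ) : ℂ) else 0)) ∂ν)

lemma sq_div_five_le_one_sub_cos {x : ℝ} (hx : |x| ≤ 2) : x ^ 2 / 5 ≤ 1 - Real.cos x := by
  have h1 : 1 - Real.cos x = 2 * Real.sin (|x| / 2) ^ 2 := by
    rw [Real.sin_sq_eq_half_sub, ← Real.cos_abs x]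
    ring_nf
  have h2 : 2 / Real.pi * (|x| / 2) ≤ Real.sin (|x| / 2) :=
    Real.mul_le_sin (by positivity) (by linarith [Real.pi_gt_three])
  have hpi : Real.pi ^ 2 ≤ 10 := by nlinarith [Real.pi_lt_d2, Real.pi_gt_three]
  have h3 : (2 / Real.pi * (|x| / 2)) ^ 2 ≤ Real.sin (|x| / 2) ^ 2 := by gcongr
  have h4 : (2 / Real.pi * (|x| / 2)) ^ 2 = x ^ 2 / Real.pi ^ 2 := by
    rw [← sq_abs x]; field_simp
  have h5 : x ^ 2 / 10 ≤ x ^ 2 / Real.pi ^ 2 := by gcongr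
  rw [h1]; linarith

lemma min_one_sq_le_integral_one_sub_cos (b : ℝ) :
    min 1 (b ^ 2) / 15 ≤ ∫ t in (0 : ℝ)..1, (1 - Real.cos (t * b)) := by
  have hcont : Continuous fun t : ℝ => 1 - Real.cos (t * b) := by fun_prop
  rcases le_total |b| 2 with hb | hb
  · have h1 : ∫ t in (0 : ℝ)..1, (t * b) ^ 2 / 5 = b ^ 2 / 15 := by
      simp_rw [mul_pow, mul_div_assoc]
      rw [intervalIntegral.integral_mul_const, integral_pow]
      ring
    have h2 : ∫ t in (0 : ℝ)..1, (t * b) ^ 2 / 5 ≤ ∫ t in (0 : ℝ)..1, (1 - Real.cos (t * b)) := by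
      refine intervalIntegral.integral_mono_on zero_le_one
        (Continuous.intervalIntegrable (by fun_prop) _ _) (hcont.intervalIntegrable _ _) ?_
      intro t ht
      refine sq_div_five_le_one_sub_cos ?_
      rw [abs_mul, abs_of_nonneg ht.1]
      nlinarith [ht.1, ht.2, abs_nonneg b]
    have h3 : min 1 (b ^ 2) ≤ b ^ 2 := min_le_right _ _
    linarith
  · have hb0 : b ≠ 0 := by rintro rfl; simp at hb; linarith
    have h1 : ∫ t in (0 : ℝ)..1, (1 - Real.cos (t * b)) = 1 - Real.sin b / b := by
      rw [intervalIntegral.integral_sub (by simp) (Continuous.intervalIntegrable (by fun_prop) _ _),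
        intervalIntegral.integral_comp_mul_right (fun x => Real.cos x) hb0]
      simp [div_eq_inv_mul]
    have h2 : Real.sin b / b ≤ 1 / 2 := by
      refine (le_abs_self _).trans ?_
      rw [abs_div, div_le_div_iff₀ (by linarith) two_pos]
      linarith [Real.abs_sin_le_one b]
    have h3 : min 1 (b ^ 2) ≤ 1 := min_le_left _ _
    rw [h1]; linarith

lemma norm_exp_I_mul_sub_one_sub_le_sq (x : ℝ) :
    ‖Complex.exp (Complex.I * x) - 1 - Complex.I * x‖ ≤ x ^ 2 := by
  have h := Convex.norm_image_sub_le_of_norm_hasDerivWithin_le (𝕜 := ℝ)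
    (f := fun y : ℝ => Complex.exp (Complex.I * y) - 1 - Complex.I * y)
    (f' := fun y : ℝ => Complex.exp (Complex.I * y) * (Complex.I * 1) - Complex.I * 1)
    (s := Icc (-|x|) |x|) (x := 0) (y := x) (C := |x|) ?_ ?_ (convex_Icc _ _) (by simp)
    ⟨neg_abs_le x, le_abs_self x⟩
  · simpa [← abs_mul, ← sq] using h
  · intro y _
    have h1 : HasDerivAt (fun y : ℝ => Complex.I * (y : ℂ)) (Complex.I * 1) y :=
      (Complex.ofRealCLM.hasDerivAt (x := y)).const_mul Complex.I
    exact ((h1.cexp.sub_const 1).sub h1).hasDerivWithinAt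
  · intro y hy
    have : Complex.exp (Complex.I * y) * (Complex.I * 1) - Complex.I * 1
        = (Complex.exp (Complex.I * y) - 1) * Complex.I := by ring
    rw [this, norm_mul, Complex.norm_I, mul_one]
    exact Real.norm_exp_I_mul_ofReal_sub_one_le.trans (abs_le.2 hy)

lemma norm_exp_sub_one_le_of_re_nonpos {z : ℂ} (hz : z.re ≤ 0) : ‖Complex.exp z - 1‖ ≤ ‖z‖ := by
  have h := Convex.norm_image_sub_le_of_norm_hasDerivWithin_le (𝕜 := ℂ)
    (f := Complex.exp) (f' := Complex.exp) (s := {w : ℂ | w.re ≤ 0}) (x := 0) (y := z) (C := 1)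
    (fun w _ => (Complex.hasDerivAt_exp w).hasDerivWithinAt) ?_ (convex_halfSpace_re_le 0)
    (by simp) hz
  · simpa using h
  · intro w hw
    rw [Complex.norm_exp]
    exact Real.exp_le_one_iff.2 hw

lemma tendsto_exp_mul_sub_one_div {L : ℝ → ℂ} {l : ℂ}
    (hL : Tendsto (fun t : ℝ => L t / t) (𝓝[>] 0) (𝓝 l)) :
    Tendsto (fun t : ℝ => (Complex.exp (L t) - 1) / t) (𝓝[>] 0) (𝓝 l) := by
  have ht : Tendsto (fun t : ℝ => (t : ℂ)) (𝓝[>] 0) (𝓝 0) := by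
    have : Continuous fun t : ℝ => (t : ℂ) := by fun_prop
    exact (this.tendsto' 0 0 (by simp)).mono_left nhdsWithin_le_nhds
  have hL0 : Tendsto L (𝓝[>] 0) (𝓝 0) := by
    have := hL.mul ht
    rw [mul_zero] at this
    refine this.congr' ?_
    filter_upwards [self_mem_nhdsWithin] with t (h : 0 < t)
    have : (t : ℂ) ≠ 0 := by exact_mod_cast h.ne'
    field_simp
  have hslope : Tendsto (dslope Complex.exp 0) (𝓝 0) (𝓝 1) := by
    have := (continuousAt_dslope_same.2 (Complex.differentiableAt_exp (x := 0))).tendsto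
    simpa using this
  have := (hslope.comp hL0).mul hL
  rw [one_mul] at this
  refine this.congr fun t => ?_
  have h := sub_smul_dslope Complex.exp 0 (L t)
  simp only [sub_zero, smul_eq_mul, Complex.exp_zero] at h
  simp only [Function.comp_apply]
  rw [← h]; ring

lemma setLIntegral_Ioi_comp_add_right (f : ℝ → ℝ≥0∞) (s : ℝ) :
    ∫⁻ v in Ioi 0, f (v + s) = ∫⁻ v in Ioi s, f v := by
  have h := (measurePreserving_add_right volume s).setLIntegral_comp_preimage_emb
    (measurableEmbedding_addRight s) f (Ioi s)
  rw [← h]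
  simp

lemma setIntegral_Ioi_comp_add_right (f : ℝ → ℂ) (s : ℝ) :
    ∫ v in Ioi 0, f (v + s) = ∫ v in Ioi s, f v := by
  have h := (measurePreserving_add_right volume s).setIntegral_preimage_emb
    (measurableEmbedding_addRight s) f (Ioi s)
  rw [← h]
  simp

/-- The logarithmic integral `∫₀^∞ (1 - cos (e^{-v} a)) dv`. -/
def cosDecay (a : ℝ) : ℝ≥0∞ :=
  ∫⁻ v in Ioi (0 : ℝ), ENNReal.ofReal (1 - Real.cos (Real.exp (-v) * a))

lemma cosDecay_abs (a : ℝ) : cosDecay |a| = cosDecay a := by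
  rcases abs_choice a with h | h <;> simp [cosDecay, h]

lemma cosDecay_exp_mul_le {s : ℝ} (hs : 0 ≤ s) (a : ℝ) :
    cosDecay (Real.exp (-s) * a) ≤ cosDecay a := by
  unfold cosDecay
  calc ∫⁻ v in Ioi (0 : ℝ), ENNReal.ofReal (1 - Real.cos (Real.exp (-v) * (Real.exp (-s) * a)))
      = ∫⁻ v in Ioi (0 : ℝ), ENNReal.ofReal (1 - Real.cos (Real.exp (-(v + s)) * a)) := by
        simp_rw [neg_add, Real.exp_add, mul_assoc]
    _ = ∫⁻ v in Ioi s, ENNReal.ofReal (1 - Real.cos (Real.exp (-v) * a)) :=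
        setLIntegral_Ioi_comp_add_right
          (fun v => ENNReal.ofReal (1 - Real.cos (Real.exp (-v) * a))) s
    _ ≤ _ := lintegral_mono_set (Ioi_subset_Ioi hs)

lemma cosDecay_mono {a b : ℝ} (h : |a| ≤ |b|) : cosDecay a ≤ cosDecay b := by
  rcases eq_or_ne a 0 with rfl | ha
  · simp [cosDecay]
  have ha' : 0 < |a| := abs_pos.2 ha
  have hb' : 0 < |b| := ha'.trans_le h
  have h1 : |a| = Real.exp (-(Real.log (|b| / |a|))) * |b| := by
    rw [← Real.log_inv, Real.exp_log (by positivity)]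
    field_simp
  rw [← cosDecay_abs a, ← cosDecay_abs b, h1]
  exact cosDecay_exp_mul_le (Real.log_nonneg ((one_le_div ha').2 h)) _

lemma cosDecay_two_mul_le (a : ℝ) : cosDecay (2 * a) ≤ 4 * cosDecay a := by
  unfold cosDecay
  rw [← lintegral_const_mul _ (by fun_prop)]
  refine lintegral_mono fun v => ?_
  have h4 : (4 : ℝ≥0∞) = ENNReal.ofReal 4 := by simp
  rw [h4, ← ENNReal.ofReal_mul (by norm_num)]
  refine ENNReal.ofReal_le_ofReal ?_
  have : Real.exp (-v) * (2 * a) = 2 * (Real.exp (-v) * a) := by ring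
  rw [this, Real.cos_two_mul]
  nlinarith [sq_nonneg (Real.cos (Real.exp (-v) * a) - 1)]

lemma lintegral_min_one_sq_le_cosDecay (a : ℝ) :
    ∫⁻ v in Ioi (0 : ℝ), ENNReal.ofReal (min 1 ((Real.exp (-v) * a) ^ 2) / 15) ≤ cosDecay a := by
  calc ∫⁻ v in Ioi (0 : ℝ), ENNReal.ofReal (min 1 ((Real.exp (-v) * a) ^ 2) / 15)
      ≤ ∫⁻ v in Ioi (0 : ℝ), ∫⁻ t in Ioc (0 : ℝ) 1,
          ENNReal.ofReal (1 - Real.cos (t * (Real.exp (-v) * a))) := by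
        refine lintegral_mono fun v => ?_
        have hc : Continuous fun t : ℝ => 1 - Real.cos (t * (Real.exp (-v) * a)) := by fun_prop
        rw [← ofReal_integral_eq_lintegral_ofReal
          ((intervalIntegrable_iff_integrableOn_Ioc_of_le zero_le_one).1
            (hc.intervalIntegrable 0 1))
          (Eventually.of_forall fun t => sub_nonneg.2 (Real.cos_le_one _)),
          ← intervalIntegral.integral_of_le zero_le_one]
        exact ENNReal.ofReal_le_ofReal (min_one_sq_le_integral_one_sub_cos _)
    _ = ∫⁻ t in Ioc (0 : ℝ) 1, ∫⁻ v in Ioi (0 : ℝ),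
          ENNReal.ofReal (1 - Real.cos (t * (Real.exp (-v) * a))) :=
        lintegral_lintegral_swap (by unfold Function.uncurry; fun_prop)
    _ ≤ ∫⁻ t in Ioc (0 : ℝ) 1, cosDecay a := by
        refine setLIntegral_mono' measurableSet_Ioc fun t ht => ?_
        have : cosDecay (t * a) ≤ cosDecay a := by
          refine cosDecay_mono ?_
          rw [abs_mul, abs_of_pos ht.1]
          exact mul_le_of_le_one_left (abs_nonneg a) ht.2
        refine le_trans (le_of_eq ?_) this
        simp_rw [cosDecay, mul_left_comm]
    _ = cosDecay a := by simp

lemma setLIntegral_Ioo_div_eq_exp (f : ℝ → ℝ≥0∞) {s : ℝ} (hs : 0 < s) :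
    ∫⁻ r in Ioo 0 s, f r * ENNReal.ofReal (1 / r) = ∫⁻ v in Ioi 0, f (Real.exp (-v) * s) := by
  have himg : (fun v : ℝ => Real.exp (-v) * s) '' Ioi 0 = Ioo 0 s := by
    ext r
    constructor
    · rintro ⟨v, hv, rfl⟩
      have : Real.exp (-v) < 1 := Real.exp_lt_one_iff.2 (neg_lt_zero.2 hv)
      exact ⟨by positivity, by nlinarith⟩
    · rintro ⟨h0, h1⟩
      refine ⟨Real.log (s / r), Real.log_pos ((one_lt_div h0).2 h1), ?_⟩
      simp only
      rw [← Real.log_inv, Real.exp_log (by positivity)]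
      field_simp
  rw [← himg, lintegral_image_eq_lintegral_abs_deriv_mul measurableSet_Ioi
    (f' := fun v => Real.exp (-v) * (-1) * s)
    (fun v _ => (((hasDerivAt_neg v).exp).mul_const s).hasDerivWithinAt)]
  · refine lintegral_congr fun v => ?_
    have : |Real.exp (-v) * (-1) * s| = Real.exp (-v) * s := by
      rw [abs_mul, abs_mul, abs_of_pos hs, Real.abs_exp]; simp
    rw [this, mul_comm (f _), ← mul_assoc, ← ENNReal.ofReal_mul (by positivity),
      mul_one_div_cancel (by positivity), ENNReal.ofReal_one, one_mul]
  · intro v _ w _ h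
    simpa [hs.ne'] using h

/-- Integrating a measurable function against `τ (r, ∞) dr / r` amounts to integrating its
exponentially discounted version against `τ`. -/
lemma setLIntegral_tail_div_eq (τ : Measure ℝ) [SFinite τ] (hτ : τ (Iic 0) = 0)
    {f : ℝ → ℝ≥0∞} (hf : Measurable f) :
    ∫⁻ r in Ioi (0 : ℝ), f r * (ENNReal.ofReal (1 / r) * τ (Ioi r))
      = ∫⁻ s, (∫⁻ v in Ioi (0 : ℝ), f (Real.exp (-v) * s)) ∂τ := by
  have hpos : ∀ᵐ s ∂τ, 0 < s := by
    rw [ae_iff]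
    simpa [Iic] using hτ
  calc ∫⁻ r in Ioi (0 : ℝ), f r * (ENNReal.ofReal (1 / r) * τ (Ioi r))
      = ∫⁻ r in Ioi (0 : ℝ), ∫⁻ s, {p : ℝ × ℝ | p.1 < p.2}.indicator
          (fun p => f p.1 * ENNReal.ofReal (1 / p.1)) (r, s) ∂τ := by
        refine lintegral_congr fun r => ?_
        have : (fun s => {p : ℝ × ℝ | p.1 < p.2}.indicator
          (fun p => f p.1 * ENNReal.ofReal (1 / p.1)) (r, s))
          = (Ioi r).indicator fun _ => f r * ENNReal.ofReal (1 / r) := by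
          ext s; simp [indicator]
        rw [this, lintegral_indicator_const measurableSet_Ioi, mul_assoc]
    _ = ∫⁻ s, (∫⁻ r in Ioi (0 : ℝ), {p : ℝ × ℝ | p.1 < p.2}.indicator
          (fun p => f p.1 * ENNReal.ofReal (1 / p.1)) (r, s)) ∂τ := by
        refine lintegral_lintegral_swap (Measurable.aemeasurable ?_)
        exact Measurable.indicator (by fun_prop) (measurableSet_lt measurable_fst measurable_snd)
    _ = ∫⁻ s, (∫⁻ v in Ioi (0 : ℝ), f (Real.exp (-v) * s)) ∂τ := by
        refine lintegral_congr_ae (hpos.mono fun s hs => ?_)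
        have : (fun r => {p : ℝ × ℝ | p.1 < p.2}.indicator
          (fun p => f p.1 * ENNReal.ofReal (1 / p.1)) (r, s))
          = (Iio s).indicator fun r => f r * ENNReal.ofReal (1 / r) := by
          ext r; simp [indicator]
        simp only
        rw [this, setLIntegral_indicator measurableSet_Iio, inter_comm, Ioi_inter_Iio,
          setLIntegral_Ioo_div_eq_exp f hs]

lemma sigmaFinite_of_Ioc_of_Iic (τ : Measure ℝ) (hfin : ∀ a c, 0 < a → a ≤ c → τ (Ioc a c) < ∞)
    (h0 : τ (Iic 0) = 0) : SigmaFinite τ := by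
  refine ⟨⟨⟨fun n : ℕ => Iic 0 ∪ Ioc (1 / ((n : ℝ) + 1)) (n + 1), fun _ => mem_univ _,
    fun n => ?_, ?_⟩⟩⟩
  · refine measure_union_lt_top (by simp [h0]) (hfin _ _ (by positivity) ?_)
    rw [div_le_iff₀ (by positivity)]
    nlinarith [n.cast_nonneg (α := ℝ)]
  · refine eq_univ_of_forall fun x => ?_
    rcases le_or_gt x 0 with hx | hx
    · exact mem_iUnion.2 ⟨0, Or.inl hx⟩
    · obtain ⟨n, hn⟩ := exists_nat_one_div_lt hx
      obtain ⟨m, hm⟩ := exists_nat_ge x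
      refine mem_iUnion.2 ⟨max n m, Or.inr ⟨lt_of_le_of_lt ?_ hn, ?_⟩⟩
      · gcongr; exact le_max_left n m
      · have : (m : ℝ) ≤ (max n m : ℕ) := by exact_mod_cast le_max_right n m
        linarith

lemma measure_Ioi_eq_ofReal_of_tendsto {τ : Measure ℝ} {k : ℝ → ℝ} {r : ℝ}
    (hτ : ∀ c, r ≤ c → τ (Ioc r c) = ENNReal.ofReal (k r - k c))
    (hk : Tendsto k atTop (𝓝 0)) : τ (Ioi r) = ENNReal.ofReal (k r) := by
  have hmono : Monotone fun n : ℕ => Ioc r (r + n) := fun m n h =>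
    Ioc_subset_Ioc_right (by gcongr)
  have hU : ⋃ n : ℕ, Ioc r (r + n) = Ioi r := by
    ext x
    simp only [mem_iUnion, mem_Ioc, mem_Ioi, exists_and_left, and_iff_left_iff_imp]
    intro _
    obtain ⟨n, hn⟩ := exists_nat_ge (x - r)
    exact ⟨n, by linarith⟩
  have h1 := tendsto_measure_iUnion_atTop (μ := τ) hmono
  rw [hU] at h1
  have h2 : Tendsto (fun n : ℕ => ENNReal.ofReal (k r - k (r + n))) atTop
      (𝓝 (ENNReal.ofReal (k r - 0))) :=
    ENNReal.tendsto_ofReal (tendsto_const_nhds.sub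
      (hk.comp (tendsto_atTop_add_const_left _ _ tendsto_natCast_atTop_atTop)))
  rw [sub_zero] at h2
  refine tendsto_nhds_unique (h1.congr fun n => ?_) h2
  exact hτ _ (by simp)

/-- `ν` is the image of `du ⊗ νt` on `(0, ∞) × E` under `(v, u) ↦ e^{-v} u`. -/
def IsExpDiscount {E : Type*} [MeasurableSpace E] [SMul ℝ E] (ν νt : Measure E) : Prop :=
  ∀ f : E → ℝ≥0∞, Measurable f →
    ∫⁻ u, f u ∂ν = ∫⁻ u, (∫⁻ v in Ioi (0 : ℝ), f (Real.exp (-v) • u)) ∂νt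

section

variable {d : ℕ} {ν νt : Measure (EuclideanSpace ℝ (Fin d))}

lemma isExpDiscount_of_polar {σ : Measure (EuclideanSpace ℝ (Fin d))}
    {τ : EuclideanSpace ℝ (Fin d) → Measure ℝ} {k : EuclideanSpace ℝ (Fin d) → ℝ → ℝ}
    (hpolar : ∀ g : EuclideanSpace ℝ (Fin d) → ℝ≥0∞, Measurable g →
      ∫⁻ u, g u ∂ν
        = ∫⁻ x, (∫⁻ r in Ioi (0 : ℝ), g (r • x) * ENNReal.ofReal (k x r / r)) ∂σ)
    (hνt : ∀ g : EuclideanSpace ℝ (Fin d) → ℝ≥0∞, Measurable g →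
      ∫⁻ u, g u ∂νt = ∫⁻ x, (∫⁻ r, g (r • x) ∂(τ x)) ∂σ)
    (hτ : ∀ᵐ x ∂σ, SigmaFinite (τ x) ∧ τ x (Iic 0) = 0 ∧
      ∀ r, 0 < r → τ x (Ioi r) = ENNReal.ofReal (k x r)) :
    IsExpDiscount ν νt := by
  intro f hf
  rw [hpolar f hf, hνt _ (Measurable.lintegral_prod_right'
    (f := fun p : EuclideanSpace ℝ (Fin d) × ℝ => f (Real.exp (-p.2) • p.1)) (by fun_prop))]
  refine lintegral_congr_ae (hτ.mono fun x hx => ?_)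
  obtain ⟨hs, h0, hk⟩ := hx
  have h := setLIntegral_tail_div_eq (τ x) h0 (f := fun r => f (r • x)) (by fun_prop)
  simp only [mul_smul] at h
  refine Eq.trans ?_ h
  refine setLIntegral_congr_fun measurableSet_Ioi fun r (hr : 0 < r) => ?_
  rw [hk r hr, ← ENNReal.ofReal_mul (by positivity), one_div, div_eq_inv_mul]

lemma IsExpDiscount.lintegral_one_sub_cos (h : IsExpDiscount ν νt)
    (ξ : EuclideanSpace ℝ (Fin d)) :
    ∫⁻ u, ENNReal.ofReal (1 - Real.cos ⟪ξ, u⟫) ∂ν = ∫⁻ u, cosDecay ⟪ξ, u⟫ ∂νt := by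
  rw [h _ (by fun_prop)]
  simp_rw [cosDecay, real_inner_smul_right]

lemma IsExpDiscount.lintegral_one_sub_cos_smul_eq_top (h : IsExpDiscount ν νt)
    {ξ : EuclideanSpace ℝ (Fin d)} (hξ : ∫⁻ u, ENNReal.ofReal (1 - Real.cos ⟪ξ, u⟫) ∂ν = ∞)
    {t : ℝ} (ht : t ≠ 0) : ∫⁻ u, ENNReal.ofReal (1 - Real.cos ⟪t • ξ, u⟫) ∂ν = ∞ := by
  rw [h.lintegral_one_sub_cos] at hξ ⊢
  have hpow : ∀ (n : ℕ) (a : ℝ), cosDecay (2 ^ n * a) ≤ 4 ^ n * cosDecay a := by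
    intro n a
    induction n with
    | zero => simp
    | succ n ih =>
      calc cosDecay (2 ^ (n + 1) * a) = cosDecay (2 * (2 ^ n * a)) := by ring_nf
        _ ≤ 4 * cosDecay (2 ^ n * a) := cosDecay_two_mul_le _
        _ ≤ 4 * (4 ^ n * cosDecay a) := by gcongr
        _ = _ := by ring
  obtain ⟨n, hn⟩ := pow_unbounded_of_one_lt (|t|⁻¹) one_lt_two
  have ht' : 0 < |t| := abs_pos.2 ht
  have h1 : 1 ≤ 2 ^ n * |t| := by
    have := mul_le_mul_of_nonneg_right hn.le ht'.le
    rwa [inv_mul_cancel₀ ht'.ne'] at this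
  have h2 : ∫⁻ u, cosDecay ⟪ξ, u⟫ ∂νt ≤ 4 ^ n * ∫⁻ u, cosDecay ⟪t • ξ, u⟫ ∂νt := by
    rw [← lintegral_const_mul' _ _ (by simp)]
    refine lintegral_mono fun u => le_trans (cosDecay_mono ?_) (hpow n _)
    rw [real_inner_smul_left, abs_mul, abs_mul, ← mul_assoc,
      abs_of_nonneg (show (0 : ℝ) ≤ 2 ^ n by positivity)]
    exact le_mul_of_one_le_left (abs_nonneg _) h1
  rw [hξ, top_le_iff] at h2
  by_contra hne
  exact ENNReal.mul_ne_top (by simp) hne h2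

/-- The integrand of the Lévy–Khintchine exponent. -/
def lkKernel (ξ u : EuclideanSpace ℝ (Fin d)) : ℂ :=
  Complex.exp (Complex.I * ((⟪ξ, u⟫ : ℝ) : ℂ)) - 1
    - (if ‖u‖ ≤ 1 then Complex.I * ((⟪ξ, u⟫ : ℝ) : ℂ) else 0)

lemma phiLK_eq (b : EuclideanSpace ℝ (Fin d)) (ν : Measure (EuclideanSpace ℝ (Fin d)))
    (ξ : EuclideanSpace ℝ (Fin d)) :
    phiLK b ν ξ = Complex.exp (Complex.I * ((⟪b, ξ⟫ : ℝ) : ℂ) + ∫ u, lkKernel ξ u ∂ν) := rfl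

lemma re_lkKernel (ξ u : EuclideanSpace ℝ (Fin d)) :
    (lkKernel ξ u).re = -(1 - Real.cos ⟪ξ, u⟫) := by
  unfold lkKernel
  rw [mul_comm Complex.I, Complex.sub_re, Complex.sub_re, Complex.exp_ofReal_mul_I_re]
  split_ifs <;> simp

lemma measurable_lkKernel (ξ : EuclideanSpace ℝ (Fin d)) : Measurable (lkKernel ξ) := by
  unfold lkKernel
  refine Measurable.sub (by fun_prop) (Measurable.ite ?_ (by fun_prop) measurable_const)
  exact measurableSet_le measurable_norm measurable_const

lemma integral_lkKernel_eq_zero {ξ : EuclideanSpace ℝ (Fin d)}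
    (hξ : ∫⁻ u, ENNReal.ofReal (1 - Real.cos ⟪ξ, u⟫) ∂ν = ∞) : ∫ u, lkKernel ξ u ∂ν = 0 := by
  refine integral_undef fun hint => ?_
  have h := hint.re.neg.lintegral_lt_top
  simp only [Pi.neg_apply, RCLike.re_to_complex, re_lkKernel, neg_neg] at h
  exact h.ne hξ

lemma IsExpDiscount.lintegral_one_sub_cos_ne_top {μX : Measure (EuclideanSpace ℝ (Fin d))}
    [IsProbabilityMeasure μX] {b : EuclideanSpace ℝ (Fin d)} (h : IsExpDiscount ν νt)
    (hnondeg : ∀ (v : EuclideanSpace ℝ (Fin d)) (c : ℝ), v ≠ 0 →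
      μX {x : EuclideanSpace ℝ (Fin d) | ⟪v, x⟫ = c} ≠ 1)
    (hchar : ∀ ξ, charFn μX ξ = phiLK b ν ξ) (ξ : EuclideanSpace ℝ (Fin d)) :
    ∫⁻ u, ENNReal.ofReal (1 - Real.cos ⟪ξ, u⟫) ∂ν ≠ ∞ := by
  intro hξ
  have hξ0 : ξ ≠ 0 := by rintro rfl; simp at hξ
  have hphi : ∀ t : ℝ, charFn μX (t • ξ) = Complex.exp (Complex.I * (t * ⟪b, ξ⟫ : ℝ)) := by
    intro t
    rw [hchar, phiLK_eq, real_inner_smul_right]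
    rcases eq_or_ne t 0 with rfl | ht
    · simp [lkKernel]
    · rw [integral_lkKernel_eq_zero (h.lintegral_one_sub_cos_smul_eq_top hξ ht), add_zero]
  have hmeas : Measurable fun x : EuclideanSpace ℝ (Fin d) => (⟪ξ, x⟫ : ℝ) := by fun_prop
  have : IsProbabilityMeasure (μX.map fun x => (⟪ξ, x⟫ : ℝ)) :=
    Measure.isProbabilityMeasure_map hmeas.aemeasurable
  have hmap : μX.map (fun x => (⟪ξ, x⟫ : ℝ)) = Measure.dirac ⟪b, ξ⟫ := by
    refine Measure.ext_of_charFun (funext fun t => ?_)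
    rw [charFun_dirac, charFun_apply_real, integral_map hmeas.aemeasurable
      (Continuous.aestronglyMeasurable (by fun_prop))]
    have h1 := hphi t
    unfold charFn at h1
    convert h1 using 1
    · refine integral_congr_ae (Eventually.of_forall fun x => ?_)
      simp only [real_inner_smul_left]
      push_cast; ring_nf
    · simp only [RCLike.inner_apply, conj_trivial]
      push_cast; ring_nf
  apply hnondeg ξ ⟪b, ξ⟫ hξ0
  have h2 : (μX.map fun x => (⟪ξ, x⟫ : ℝ)) {⟪b, ξ⟫} = 1 := by rw [hmap]; simp
  rwa [Measure.map_apply hmeas (measurableSet_singleton _)] at h2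

lemma IsExpDiscount.lintegral_min_one_sq_lt_top (h : IsExpDiscount ν νt)
    (hfin : ∀ ξ, ∫⁻ u, ENNReal.ofReal (1 - Real.cos ⟪ξ, u⟫) ∂ν ≠ ∞) :
    ∫⁻ u, ENNReal.ofReal (min 1 (‖u‖ ^ 2)) ∂ν < ∞ := by
  have hcoord : ∀ i : Fin d, ∫⁻ u, ENNReal.ofReal (min 1 (u i ^ 2) / 15) ∂ν < ∞ := by
    intro i
    rw [h _ (by fun_prop)]
    refine lt_of_le_of_lt (lintegral_mono fun u => ?_) (lt_top_iff_ne_top.2 ((h.lintegral_one_sub_cos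
      (EuclideanSpace.single i 1)) ▸ hfin (EuclideanSpace.single i 1)))
    have := lintegral_min_one_sq_le_cosDecay (u i)
    simpa [EuclideanSpace.inner_single_left] using this
  have hle : ∀ u : EuclideanSpace ℝ (Fin d), ENNReal.ofReal (min 1 (‖u‖ ^ 2))
      ≤ ∑ i, 15 * ENNReal.ofReal (min 1 (u i ^ 2) / 15) := by
    intro u
    have h15 : (15 : ℝ≥0∞) = ENNReal.ofReal 15 := by simp
    simp_rw [h15, ← ENNReal.ofReal_mul (show (0 : ℝ) ≤ 15 by norm_num),
      mul_div_cancel₀ _ (show (15 : ℝ) ≠ 0 by norm_num)]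
    rw [← ENNReal.ofReal_sum_of_nonneg fun i _ => by positivity]
    refine ENNReal.ofReal_le_ofReal ?_
    by_cases hu : ∃ i, 1 ≤ u i ^ 2
    · obtain ⟨i, hi⟩ := hu
      calc min 1 (‖u‖ ^ 2) ≤ 1 := min_le_left _ _
        _ = min 1 (u i ^ 2) := (min_eq_left hi).symm
        _ ≤ _ := Finset.single_le_sum (f := fun i => min 1 (u i ^ 2))
          (fun i _ => by positivity) (Finset.mem_univ i)
    · push Not at hu
      refine (min_le_right _ _).trans ?_
      rw [EuclideanSpace.real_norm_sq_eq]
      exact Finset.sum_le_sum fun i _ => (min_eq_right (hu i).le).ge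
  refine (lintegral_mono hle).trans_lt ?_
  rw [lintegral_finsetSum _ fun i _ => by fun_prop]
  refine ENNReal.sum_lt_top.2 fun i _ => ?_
  rw [lintegral_const_mul _ (by fun_prop)]
  exact ENNReal.mul_lt_top (by simp) (hcoord i)

lemma IsExpDiscount.lintegral_min_one_sq_lt_top' (h : IsExpDiscount ν νt)
    (hν : ∫⁻ u, ENNReal.ofReal (min 1 (‖u‖ ^ 2)) ∂ν < ∞) :
    ∫⁻ u, ENNReal.ofReal (min 1 (‖u‖ ^ 2)) ∂νt < ∞ := by
  rw [h _ (by fun_prop)] at hν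
  have hle : ∀ u : EuclideanSpace ℝ (Fin d),
      ENNReal.ofReal (Real.exp (-2)) * ENNReal.ofReal (min 1 (‖u‖ ^ 2))
      ≤ ∫⁻ v in Ioi (0 : ℝ), ENNReal.ofReal (min 1 (‖Real.exp (-v) • u‖ ^ 2)) := by
    intro u
    calc ENNReal.ofReal (Real.exp (-2)) * ENNReal.ofReal (min 1 (‖u‖ ^ 2))
        = ∫⁻ v in Ioc (0 : ℝ) 1,
            ENNReal.ofReal (Real.exp (-2)) * ENNReal.ofReal (min 1 (‖u‖ ^ 2)) := by simp
      _ ≤ ∫⁻ v in Ioc (0 : ℝ) 1, ENNReal.ofReal (min 1 (‖Real.exp (-v) • u‖ ^ 2)) := by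
          refine setLIntegral_mono' measurableSet_Ioc fun v hv => ?_
          rw [← ENNReal.ofReal_mul (by positivity)]
          refine ENNReal.ofReal_le_ofReal ?_
          rw [norm_smul, Real.norm_of_nonneg (by positivity), mul_pow, ← Real.exp_nat_mul]
          have h1 : Real.exp (-2) ≤ Real.exp ((2 : ℕ) * -v) := by
            rw [Real.exp_le_exp]; push_cast; linarith [hv.2]
          have h2 : Real.exp (-2) ≤ 1 := Real.exp_le_one_iff.2 (by norm_num)
          refine le_min ?_ ?_
          · exact mul_le_one₀ h2 (by positivity) (min_le_left _ _)
          · exact mul_le_mul h1 (min_le_right _ _) (by positivity) (by positivity)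
      _ ≤ _ := lintegral_mono_set Ioc_subset_Ioi_self
  have h1 := (lintegral_mono hle).trans_lt hν
  rw [lintegral_const_mul _ (by fun_prop)] at h1
  exact (ENNReal.mul_lt_top_iff.1 h1).elim (fun h => h.2)
    (fun h => h.elim (fun h => absurd h (by simp [Real.exp_pos])) (fun h => by rw [h]; exact ENNReal.zero_lt_top))

end

section

variable {d : ℕ} {ν νt : Measure (EuclideanSpace ℝ (Fin d))}

lemma sigmaFinite_of_lintegral_min_one_sq
    (hν : ∫⁻ u, ENNReal.ofReal (min 1 (‖u‖ ^ 2)) ∂ν < ∞) (h0 : ν {0} = 0) : SigmaFinite ν := by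
  refine ⟨⟨⟨fun n : ℕ => {0} ∪ {u | ENNReal.ofReal (1 / ((n : ℝ) + 1))
    ≤ ENNReal.ofReal (min 1 (‖u‖ ^ 2))}, fun _ => mem_univ _, fun n => ?_, ?_⟩⟩⟩
  · refine measure_union_lt_top (by simp [h0]) ?_
    have hne : ENNReal.ofReal (1 / ((n : ℝ) + 1)) ≠ 0 := by
      rw [ne_eq, ENNReal.ofReal_eq_zero, not_le]; positivity
    exact (meas_ge_le_lintegral_div (by fun_prop) hne ENNReal.ofReal_ne_top).trans_lt
      (ENNReal.div_lt_top hν.ne hne)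
  · refine eq_univ_of_forall fun u => ?_
    rcases eq_or_ne u 0 with rfl | hu
    · exact mem_iUnion.2 ⟨0, Or.inl rfl⟩
    · obtain ⟨n, hn⟩ := exists_nat_one_div_lt (show 0 < min 1 (‖u‖ ^ 2) by positivity)
      exact mem_iUnion.2 ⟨n, Or.inr (ENNReal.ofReal_le_ofReal hn.le)⟩

lemma integrable_min_one_sq (hν : ∫⁻ u, ENNReal.ofReal (min 1 (‖u‖ ^ 2)) ∂ν < ∞) :
    Integrable (fun u => min 1 (‖u‖ ^ 2)) ν :=
  ⟨Continuous.aestronglyMeasurable (by fun_prop),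
    (hasFiniteIntegral_iff_ofReal (Eventually.of_forall fun _ => by positivity)).2 hν⟩

lemma IsExpDiscount.eq_map [SFinite νt] (h : IsExpDiscount ν νt) :
    ν = (νt.prod (volume.restrict (Ioi (0 : ℝ)))).map fun p => Real.exp (-p.2) • p.1 := by
  ext s hs
  have hm : Measurable fun p : EuclideanSpace ℝ (Fin d) × ℝ => Real.exp (-p.2) • p.1 := by fun_prop
  have h1 := h (s.indicator 1) (measurable_one.indicator hs)
  rw [lintegral_indicator_one hs] at h1
  rw [h1, ← lintegral_indicator_one hs, lintegral_map (measurable_one.indicator hs) hm]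
  exact (lintegral_prod _ ((measurable_one.indicator hs).comp hm).aemeasurable).symm

lemma IsExpDiscount.integrable_prod [SFinite νt] (h : IsExpDiscount ν νt)
    {f : EuclideanSpace ℝ (Fin d) → ℂ} (hf : Integrable f ν) :
    Integrable (fun p : EuclideanSpace ℝ (Fin d) × ℝ => f (Real.exp (-p.2) • p.1))
      (νt.prod (volume.restrict (Ioi (0 : ℝ)))) := by
  have hm : Measurable fun p : EuclideanSpace ℝ (Fin d) × ℝ => Real.exp (-p.2) • p.1 := by fun_prop
  rw [h.eq_map] at hf
  exact (integrable_map_measure hf.aestronglyMeasurable hm.aemeasurable).1 hf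

lemma IsExpDiscount.integral_eq [SFinite νt] (h : IsExpDiscount ν νt)
    {f : EuclideanSpace ℝ (Fin d) → ℂ} (hf : Integrable f ν) :
    ∫ u, f u ∂ν = ∫ u, (∫ v in Ioi (0 : ℝ), f (Real.exp (-v) • u)) ∂νt := by
  have hm : Measurable fun p : EuclideanSpace ℝ (Fin d) × ℝ => Real.exp (-p.2) • p.1 := by fun_prop
  have h1 := integral_prod _ (h.integrable_prod hf)
  rw [← h1, ← integral_map (f := f) hm.aemeasurable (by rw [← h.eq_map]; exact hf.1), ← h.eq_map]

lemma IsExpDiscount.integral_sub_integral_smul [SFinite νt] (h : IsExpDiscount ν νt)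
    {f : EuclideanSpace ℝ (Fin d) → ℂ} (hf : Integrable f ν) {t : ℝ} (ht : 0 ≤ t)
    (hft : Integrable (fun u => f (Real.exp (-t) • u)) ν) :
    ∫ u, f u ∂ν - ∫ u, f (Real.exp (-t) • u) ∂ν
      = ∫ u, (∫ v in Ioc 0 t, f (Real.exp (-v) • u)) ∂νt := by
  rw [h.integral_eq hf, h.integral_eq hft, ← integral_sub (h.integrable_prod hf).integral_prod_left
    (h.integrable_prod hft).integral_prod_left]
  refine integral_congr_ae ((h.integrable_prod hf).prod_right_ae.mono fun u hu => ?_)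
  have h1 : ∫ v in Ioi (0 : ℝ), f (Real.exp (-t) • Real.exp (-v) • u)
      = ∫ v in Ioi t, f (Real.exp (-v) • u) := by
    rw [← setIntegral_Ioi_comp_add_right (fun v => f (Real.exp (-v) • u)) t]
    refine integral_congr_ae (Eventually.of_forall fun v => ?_)
    simp only [smul_smul, ← Real.exp_add]
    ring_nf
  have hu' : IntegrableOn (fun v => f (Real.exp (-v) • u)) (Ioi 0) := hu
  simp only
  rw [h1, ← Ioc_union_Ioi_eq_Ioi ht, setIntegral_union (Ioc_disjoint_Ioi le_rfl) measurableSet_Ioi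
    (hu'.mono_set Ioc_subset_Ioi_self) (hu'.mono_set (Ioi_subset_Ioi ht))]
  ring

lemma norm_lkKernel_le_of_norm_le_one (ξ : EuclideanSpace ℝ (Fin d))
    {u : EuclideanSpace ℝ (Fin d)} (hu : ‖u‖ ≤ 1) : ‖lkKernel ξ u‖ ≤ ‖ξ‖ ^ 2 * ‖u‖ ^ 2 := by
  unfold lkKernel
  rw [if_pos hu, ← mul_pow]
  refine (norm_exp_I_mul_sub_one_sub_le_sq _).trans ?_
  rw [← sq_abs]
  gcongr
  exact abs_real_inner_le_norm _ _

lemma norm_lkKernel_le_two (ξ : EuclideanSpace ℝ (Fin d))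
    {u : EuclideanSpace ℝ (Fin d)} (hu : 1 < ‖u‖) : ‖lkKernel ξ u‖ ≤ 2 := by
  unfold lkKernel
  rw [if_neg hu.not_ge, sub_zero]
  refine (norm_sub_le _ _).trans ?_
  rw [Complex.norm_exp_I_mul_ofReal, norm_one]; norm_num

/-- The common majorant of the Lévy–Khintchine integrand along the contractions `e^{-v} u`. -/
def lkBound (ξ u : EuclideanSpace ℝ (Fin d)) : ℝ :=
  if ‖u‖ ≤ 1 then ‖ξ‖ ^ 2 * ‖u‖ ^ 2 else 2 + ‖ξ‖ ^ 2

lemma norm_lkKernel_smul_le (ξ u : EuclideanSpace ℝ (Fin d)) {c : ℝ} (hc0 : 0 ≤ c) (hc1 : c ≤ 1) :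
    ‖lkKernel ξ (c • u)‖ ≤ lkBound ξ u := by
  have hcu : ‖c • u‖ ≤ ‖u‖ := by
    rw [norm_smul, Real.norm_of_nonneg hc0]; exact mul_le_of_le_one_left (norm_nonneg _) hc1
  unfold lkBound
  split_ifs with hu
  · refine (norm_lkKernel_le_of_norm_le_one ξ (hcu.trans hu)).trans ?_
    gcongr
  · rcases le_or_gt ‖c • u‖ 1 with h1 | h1
    · refine (norm_lkKernel_le_of_norm_le_one ξ h1).trans ?_
      have : ‖c • u‖ ^ 2 ≤ 1 := pow_le_one₀ (norm_nonneg _) h1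
      nlinarith [sq_nonneg ‖ξ‖]
    · exact (norm_lkKernel_le_two ξ h1).trans (by nlinarith [sq_nonneg ‖ξ‖])

lemma lkBound_le (ξ u : EuclideanSpace ℝ (Fin d)) :
    lkBound ξ u ≤ (2 + ‖ξ‖ ^ 2) * min 1 (‖u‖ ^ 2) := by
  unfold lkBound
  split_ifs with hu
  · rw [min_eq_right (pow_le_one₀ (norm_nonneg _) hu)]
    nlinarith [sq_nonneg ‖u‖]
  · rw [min_eq_left (one_le_pow₀ (not_le.1 hu).le), mul_one]

lemma measurable_lkBound (ξ : EuclideanSpace ℝ (Fin d)) : Measurable (lkBound ξ) := by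
  unfold lkBound
  exact Measurable.ite (measurableSet_le measurable_norm measurable_const) (by fun_prop)
    measurable_const

lemma lkBound_nonneg (ξ u : EuclideanSpace ℝ (Fin d)) : 0 ≤ lkBound ξ u := by
  unfold lkBound; split_ifs <;> positivity

lemma integrable_lkBound (hν : ∫⁻ u, ENNReal.ofReal (min 1 (‖u‖ ^ 2)) ∂ν < ∞)
    (ξ : EuclideanSpace ℝ (Fin d)) : Integrable (lkBound ξ) ν :=
  ((integrable_min_one_sq hν).const_mul (2 + ‖ξ‖ ^ 2)).mono' (measurable_lkBound ξ).aestronglyMeasurable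
    (Eventually.of_forall fun u => by
      rw [Real.norm_of_nonneg (lkBound_nonneg ξ u)]; exact lkBound_le ξ u)

lemma integrable_lkKernel_smul (hν : ∫⁻ u, ENNReal.ofReal (min 1 (‖u‖ ^ 2)) ∂ν < ∞)
    (ξ : EuclideanSpace ℝ (Fin d)) {c : ℝ} (hc0 : 0 ≤ c) (hc1 : c ≤ 1) :
    Integrable (fun u => lkKernel ξ (c • u)) ν :=
  (integrable_lkBound hν ξ).mono'
    ((measurable_lkKernel ξ).comp (measurable_const_smul c)).aestronglyMeasurable
    (Eventually.of_forall fun u => norm_lkKernel_smul_le ξ u hc0 hc1)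

lemma integrable_lkKernel (hν : ∫⁻ u, ENNReal.ofReal (min 1 (‖u‖ ^ 2)) ∂ν < ∞)
    (ξ : EuclideanSpace ℝ (Fin d)) : Integrable (lkKernel ξ) ν := by
  simpa using integrable_lkKernel_smul hν ξ zero_le_one le_rfl

/-- The change of the compensator of the Lévy–Khintchine integrand under contraction by `c`. -/
def lkJump (c : ℝ) (ξ u : EuclideanSpace ℝ (Fin d)) : ℂ :=
  if ‖c • u‖ ≤ 1 ∧ 1 < ‖u‖ then Complex.I * ((⟪ξ, c • u⟫ : ℝ) : ℂ) else 0

lemma measurable_lkJump (c : ℝ) (ξ : EuclideanSpace ℝ (Fin d)) : Measurable (lkJump c ξ) := by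
  unfold lkJump
  refine Measurable.ite (MeasurableSet.inter ?_ ?_) (by fun_prop) measurable_const
  · exact measurableSet_le (measurable_const_smul c).norm measurable_const
  · exact measurableSet_lt measurable_const measurable_norm

lemma lkKernel_smul_left {c : ℝ} (hc0 : 0 ≤ c) (hc1 : c ≤ 1) (ξ u : EuclideanSpace ℝ (Fin d)) :
    lkKernel (c • ξ) u = lkKernel ξ (c • u) + lkJump c ξ u := by
  have hcu : ‖c • u‖ ≤ ‖u‖ := by
    rw [norm_smul, Real.norm_of_nonneg hc0]; exact mul_le_of_le_one_left (norm_nonneg _) hc1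
  unfold lkKernel lkJump
  rw [real_inner_smul_left, real_inner_smul_right]
  by_cases h1 : ‖u‖ ≤ 1
  · simp [h1, hcu.trans h1]
  · by_cases h2 : ‖c • u‖ ≤ 1
    · simp [h1, h2, not_le.1 h1]
    · simp [h1, h2]

lemma norm_lkJump_le (c : ℝ) (ξ u : EuclideanSpace ℝ (Fin d)) :
    ‖lkJump c ξ u‖ ≤ ‖ξ‖ * min 1 (‖u‖ ^ 2) := by
  unfold lkJump
  split_ifs with h
  · rw [norm_mul, Complex.norm_I, one_mul, Complex.norm_real, min_eq_left (one_le_pow₀ h.2.le)]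
    exact (norm_inner_le_norm _ _).trans (mul_le_mul_of_nonneg_left h.1 (norm_nonneg _))
  · rw [norm_zero]; positivity

lemma integrable_lkJump (hν : ∫⁻ u, ENNReal.ofReal (min 1 (‖u‖ ^ 2)) ∂ν < ∞) (c : ℝ)
    (ξ : EuclideanSpace ℝ (Fin d)) : Integrable (lkJump c ξ) ν :=
  ((integrable_min_one_sq hν).const_mul ‖ξ‖).mono' (measurable_lkJump c ξ).aestronglyMeasurable
    (Eventually.of_forall fun u => norm_lkJump_le c ξ u)

/-- The increment of the Lévy–Khintchine exponent, in terms of `νt`. -/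
lemma IsExpDiscount.integral_lkKernel_sub [SFinite νt] (h : IsExpDiscount ν νt)
    (hν : ∫⁻ u, ENNReal.ofReal (min 1 (‖u‖ ^ 2)) ∂ν < ∞) (ξ : EuclideanSpace ℝ (Fin d))
    {t : ℝ} (ht : 0 ≤ t) :
    ∫ u, lkKernel ξ u ∂ν - ∫ u, lkKernel (Real.exp (-t) • ξ) u ∂ν
      = ∫ u, (∫ v in Ioc 0 t, lkKernel ξ (Real.exp (-v) • u)) ∂νt
        - ∫ u, (∫ v in Ioi (0 : ℝ), lkJump (Real.exp (-t)) ξ (Real.exp (-v) • u)) ∂νt := by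
  have hc1 : Real.exp (-t) ≤ 1 := Real.exp_le_one_iff.2 (by linarith)
  have hint := integrable_lkKernel_smul hν ξ (Real.exp_pos (-t)).le hc1
  have hj := integrable_lkJump hν (Real.exp (-t)) ξ
  simp_rw [lkKernel_smul_left (Real.exp_pos (-t)).le hc1]
  rw [integral_add hint hj, ← h.integral_eq hj,
    ← h.integral_sub_integral_smul (integrable_lkKernel hν ξ) ht hint]
  ring

lemma norm_setIntegral_lkKernel_le (ξ u : EuclideanSpace ℝ (Fin d)) {t : ℝ} (ht : 0 ≤ t) :
    ‖∫ v in Ioc 0 t, lkKernel ξ (Real.exp (-v) • u)‖ ≤ t * lkBound ξ u := by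
  have := norm_setIntegral_le_of_norm_le_const (μ := volume) (s := Ioc 0 t)
    (f := fun v => lkKernel ξ (Real.exp (-v) • u)) (C := lkBound ξ u) (by simp) fun v hv =>
      norm_lkKernel_smul_le ξ u (Real.exp_pos _).le (Real.exp_le_one_iff.2 (by linarith [hv.1]))
  rwa [Real.volume_real_Ioc_of_le ht, sub_zero, mul_comm] at this

lemma setIntegral_lkJump_eq {ξ u : EuclideanSpace ℝ (Fin d)} (hu : u ≠ 0) (t : ℝ) :
    ∫ v in Ioi (0 : ℝ), lkJump (Real.exp (-t)) ξ (Real.exp (-v) • u)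
      = ∫ v in Ioi (0 : ℝ) ∩ Ico (Real.log ‖u‖ - t) (Real.log ‖u‖),
          Complex.I * ((⟪ξ, Real.exp (-t) • Real.exp (-v) • u⟫ : ℝ) : ℂ) := by
  rw [← setIntegral_indicator measurableSet_Ico]
  refine integral_congr_ae (Eventually.of_forall fun v => ?_)
  have hu' : 0 < ‖u‖ := norm_pos_iff.2 hu
  have hexp : ∀ s : ℝ, Real.exp s * ‖u‖ = Real.exp (s + Real.log ‖u‖) := fun s => by
    rw [Real.exp_add, Real.exp_log hu']
  have hiff : (‖Real.exp (-t) • Real.exp (-v) • u‖ ≤ 1 ∧ 1 < ‖Real.exp (-v) • u‖)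
      ↔ v ∈ Ico (Real.log ‖u‖ - t) (Real.log ‖u‖) := by
    rw [smul_smul, norm_smul, norm_smul, ← Real.exp_add, Real.norm_of_nonneg (Real.exp_pos _).le,
      Real.norm_of_nonneg (Real.exp_pos _).le, hexp, hexp, Real.exp_le_one_iff, Real.one_lt_exp_iff]
    constructor
    · rintro ⟨h1, h2⟩; constructor <;> linarith
    · rintro ⟨h1, h2⟩; constructor <;> linarith
  simp only [lkJump, indicator, hiff]

lemma setIntegral_lkJump_eq_zero {u : EuclideanSpace ℝ (Fin d)} (hu : ‖u‖ ≤ 1)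
    (ξ : EuclideanSpace ℝ (Fin d)) (t : ℝ) :
    ∫ v in Ioi (0 : ℝ), lkJump (Real.exp (-t)) ξ (Real.exp (-v) • u) = 0 := by
  refine setIntegral_eq_zero_of_forall_eq_zero fun v (hv : 0 < v) => ?_
  have : ‖Real.exp (-v) • u‖ ≤ 1 := by
    rw [norm_smul, Real.norm_of_nonneg (Real.exp_pos _).le]
    exact mul_le_one₀ (Real.exp_le_one_iff.2 (by linarith)) (norm_nonneg _) hu
  simp [lkJump, this.not_gt]

lemma setIntegral_lkJump_eq_of_le {ξ u : EuclideanSpace ℝ (Fin d)} (hu : 1 < ‖u‖) {t : ℝ}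
    (ht : 0 ≤ t) (htu : t ≤ Real.log ‖u‖) :
    ∫ v in Ioi (0 : ℝ), lkJump (Real.exp (-t)) ξ (Real.exp (-v) • u)
      = (1 - Real.exp (-t) : ℝ) * (Complex.I * ((⟪ξ, ‖u‖⁻¹ • u⟫ : ℝ) : ℂ)) := by
  have hu0 : 0 < ‖u‖ := by linarith
  rw [setIntegral_lkJump_eq (norm_pos_iff.1 hu0)]
  have hset : (Ioi (0 : ℝ) ∩ Ico (Real.log ‖u‖ - t) (Real.log ‖u‖) : Set ℝ)
      =ᵐ[volume] (Ioc (Real.log ‖u‖ - t) (Real.log ‖u‖) : Set ℝ) := by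
    have h1 : Ioi (0 : ℝ) ∩ Ioo (Real.log ‖u‖ - t) (Real.log ‖u‖)
        = Ioo (Real.log ‖u‖ - t) (Real.log ‖u‖) :=
      inter_eq_right.2 fun v hv => lt_of_le_of_lt (by linarith) hv.1
    refine ((ae_eq_refl _).inter Ioo_ae_eq_Ico.symm).trans ?_
    rw [h1]
    exact Ioo_ae_eq_Ioc
  rw [setIntegral_congr_set hset, ← intervalIntegral.integral_of_le (by linarith)]
  have hfun : ∀ v : ℝ, Complex.I * ((⟪ξ, Real.exp (-t) • Real.exp (-v) • u⟫ : ℝ) : ℂ)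
      = ((Real.exp (-v) : ℝ) : ℂ) * (Complex.I * ((Real.exp (-t) * ⟪ξ, u⟫ : ℝ) : ℂ)) := by
    intro v
    rw [real_inner_smul_right, real_inner_smul_right]
    push_cast; ring
  simp_rw [hfun]
  rw [intervalIntegral.integral_mul_const, intervalIntegral.integral_ofReal,
    intervalIntegral.integral_comp_neg (fun x => Real.exp x), integral_exp, neg_sub,
    Real.exp_sub, Real.exp_neg (Real.log _), Real.exp_log hu0, real_inner_smul_right]
  have : Real.exp t * Real.exp (-t) = 1 := by rw [← Real.exp_add]; simp
  have h2 : (Real.exp t / ‖u‖ - ‖u‖⁻¹) * (Real.exp (-t) * ⟪ξ, u⟫)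
      = (1 - Real.exp (-t)) * (‖u‖⁻¹ * ⟪ξ, u⟫) := by
    linear_combination (‖u‖⁻¹ * ⟪ξ, u⟫) * this
  have h3 := congrArg (fun x : ℝ => Complex.I * (x : ℂ)) h2
  push_cast at h3 ⊢
  linear_combination h3

lemma norm_setIntegral_lkJump_le (ξ u : EuclideanSpace ℝ (Fin d)) {t : ℝ} (ht : 0 ≤ t) :
    ‖∫ v in Ioi (0 : ℝ), lkJump (Real.exp (-t)) ξ (Real.exp (-v) • u)‖
      ≤ {w : EuclideanSpace ℝ (Fin d) | 1 < ‖w‖}.indicator (fun _ => t * ‖ξ‖) u := by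
  rcases le_or_gt ‖u‖ 1 with hu | hu
  · rw [setIntegral_lkJump_eq_zero hu, norm_zero]
    exact indicator_nonneg (fun _ _ => by positivity) _
  · have hu0 : u ≠ 0 := norm_pos_iff.1 (by linarith)
    rw [indicator_of_mem (show u ∈ {w : EuclideanSpace ℝ (Fin d) | 1 < ‖w‖} from hu),
      setIntegral_lkJump_eq hu0]
    have hvol : volume (Ioi (0 : ℝ) ∩ Ico (Real.log ‖u‖ - t) (Real.log ‖u‖)) ≤ ENNReal.ofReal t := by
      refine (measure_mono inter_subset_right).trans ?_
      rw [Real.volume_Ico]; simp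
    have := norm_setIntegral_le_of_norm_le_const (μ := volume)
      (s := Ioi (0 : ℝ) ∩ Ico (Real.log ‖u‖ - t) (Real.log ‖u‖))
      (f := fun v => Complex.I * ((⟪ξ, Real.exp (-t) • Real.exp (-v) • u⟫ : ℝ) : ℂ))
      (C := ‖ξ‖) (hvol.trans_lt ENNReal.ofReal_lt_top) ?_
    · refine this.trans ?_
      rw [mul_comm]
      exact mul_le_mul_of_nonneg_right (ENNReal.toReal_le_of_le_ofReal ht hvol) (norm_nonneg _)
    · rintro v ⟨-, hv⟩
      rw [norm_mul, Complex.norm_I, one_mul, Complex.norm_real]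
      refine (norm_inner_le_norm _ _).trans (mul_le_of_le_one_right (norm_nonneg _) ?_)
      rw [smul_smul, norm_smul, ← Real.exp_add, Real.norm_of_nonneg (Real.exp_pos _).le,
        ← Real.exp_log (norm_pos_iff.2 hu0), ← Real.exp_add, Real.exp_le_one_iff]
      linarith [hv.1]

end

section

variable {d : ℕ} {νt : Measure (EuclideanSpace ℝ (Fin d))}

lemma tendsto_lkKernel_exp_smul (ξ u : EuclideanSpace ℝ (Fin d)) :
    Tendsto (fun v : ℝ => lkKernel ξ (Real.exp (-v) • u)) (𝓝[>] 0) (𝓝 (lkKernel ξ u)) := by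
  rcases le_or_gt ‖u‖ 1 with hu | hu
  · have hcont : Continuous fun v : ℝ =>
        Complex.exp (Complex.I * ((⟪ξ, Real.exp (-v) • u⟫ : ℝ) : ℂ)) - 1
          - Complex.I * ((⟪ξ, Real.exp (-v) • u⟫ : ℝ) : ℂ) := by fun_prop
    have h := (hcont.tendsto 0).mono_left (nhdsWithin_le_nhds (s := Ioi 0))
    simp only [neg_zero, Real.exp_zero, one_smul] at h
    rw [lkKernel, if_pos hu]
    refine h.congr' (eventually_mem_nhdsWithin.mono fun v (hv : 0 < v) => ?_)
    have : ‖Real.exp (-v) • u‖ ≤ 1 := by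
      rw [norm_smul, Real.norm_of_nonneg (Real.exp_pos _).le]
      exact mul_le_one₀ (Real.exp_le_one_iff.2 (by linarith)) (norm_nonneg _) hu
    simp only [lkKernel, if_pos this]
  · have hcont : Continuous fun v : ℝ =>
        Complex.exp (Complex.I * ((⟪ξ, Real.exp (-v) • u⟫ : ℝ) : ℂ)) - 1 - 0 := by fun_prop
    have h := (hcont.tendsto 0).mono_left (nhdsWithin_le_nhds (s := Ioi 0))
    simp only [neg_zero, Real.exp_zero, one_smul] at h
    rw [lkKernel, if_neg hu.not_ge]
    have hn : Tendsto (fun v : ℝ => ‖Real.exp (-v) • u‖) (𝓝 0) (𝓝 ‖u‖) := by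
      have : Continuous fun v : ℝ => ‖Real.exp (-v) • u‖ := by fun_prop
      simpa using this.tendsto 0
    refine h.congr' (((hn.eventually_const_lt hu).filter_mono nhdsWithin_le_nhds).mono
      fun v hv => ?_)
    simp only [lkKernel, if_neg hv.not_ge]

lemma measurable_lkKernel_exp_smul (ξ : EuclideanSpace ℝ (Fin d)) :
    Measurable fun p : EuclideanSpace ℝ (Fin d) × ℝ => lkKernel ξ (Real.exp (-p.2) • p.1) :=
  (measurable_lkKernel ξ).comp (by fun_prop)

lemma tendsto_setIntegral_lkKernel_div (ξ u : EuclideanSpace ℝ (Fin d)) :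
    Tendsto (fun t : ℝ => (∫ v in Ioc 0 t, lkKernel ξ (Real.exp (-v) • u)) / (t : ℂ))
      (𝓝[>] 0) (𝓝 (lkKernel ξ u)) := by
  have hmeas : Measurable fun v : ℝ => lkKernel ξ (Real.exp (-v) • u) :=
    (measurable_lkKernel ξ).comp (by fun_prop)
  have h := intervalIntegral.integral_hasDerivWithinAt_of_tendsto_ae_right (a := 0) (b := 0)
    (f := fun v => lkKernel ξ (Real.exp (-v) • u)) (c := lkKernel ξ u) (s := Ici 0) (t := Ioi 0)
    (by simp) hmeas.stronglyMeasurable.stronglyMeasurableAtFilter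
    ((tendsto_lkKernel_exp_smul ξ u).mono_left inf_le_left)
  have h' := (hasDerivWithinAt_iff_tendsto_slope' (s := Ioi 0) (by simp)).1
    (h.mono Ioi_subset_Ici_self)
  refine h'.congr' (eventually_mem_nhdsWithin.mono fun t (ht : 0 < t) => ?_)
  rw [slope_def_module, intervalIntegral.integral_same, sub_zero, sub_zero,
    intervalIntegral.integral_of_le ht.le, Complex.real_smul, Complex.ofReal_inv]
  exact (div_eq_inv_mul _ _).symm

lemma tendsto_integral_setIntegral_lkKernel_div
    (hνt : ∫⁻ u, ENNReal.ofReal (min 1 (‖u‖ ^ 2)) ∂νt < ∞) (ξ : EuclideanSpace ℝ (Fin d)) :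
    Tendsto (fun t : ℝ =>
        (∫ u, (∫ v in Ioc 0 t, lkKernel ξ (Real.exp (-v) • u)) ∂νt) / (t : ℂ))
      (𝓝[>] 0) (𝓝 (∫ u, lkKernel ξ u ∂νt)) := by
  refine Tendsto.congr (fun t : ℝ => integral_div (μ := νt) (t : ℂ)
    fun u => ∫ v in Ioc 0 t, lkKernel ξ (Real.exp (-v) • u)) ?_
  refine tendsto_integral_filter_of_dominated_convergence (lkBound ξ)
    (Eventually.of_forall fun t => ?_) (eventually_mem_nhdsWithin.mono fun t (ht : 0 < t) =>
      Eventually.of_forall fun u => ?_) (integrable_lkBound hνt ξ)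
    (Eventually.of_forall fun u => tendsto_setIntegral_lkKernel_div ξ u)
  · simp_rw [div_eq_mul_inv]
    exact ((measurable_lkKernel_exp_smul ξ).stronglyMeasurable.integral_prod_right'
      (ν := volume.restrict (Ioc 0 t))).aestronglyMeasurable.mul_const _
  · rw [norm_div, Complex.norm_real, Real.norm_of_nonneg ht.le, div_le_iff₀ ht, mul_comm]
    exact norm_setIntegral_lkKernel_le ξ u ht.le

lemma tendsto_one_sub_exp_neg_div :
    Tendsto (fun t : ℝ => (1 - Real.exp (-t)) / t) (𝓝[>] 0) (𝓝 1) := by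
  have h : HasDerivAt (fun t : ℝ => 1 - Real.exp (-t)) 1 0 := by
    simpa using ((hasDerivAt_neg (0 : ℝ)).exp).const_sub 1
  have h' := (hasDerivWithinAt_iff_tendsto_slope' (s := Ioi 0) (by simp)).1 h.hasDerivWithinAt
  refine h'.congr fun t => ?_
  simp [slope_def_field]

lemma measure_one_lt_norm_lt_top (hνt : ∫⁻ u, ENNReal.ofReal (min 1 (‖u‖ ^ 2)) ∂νt < ∞) :
    νt {w | 1 < ‖w‖} < ∞ := by
  have h := meas_ge_le_lintegral_div (μ := νt)
    (f := fun u : EuclideanSpace ℝ (Fin d) => ENNReal.ofReal (min 1 (‖u‖ ^ 2)))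
    (by fun_prop) one_ne_zero ENNReal.one_ne_top
  rw [div_one] at h
  refine (measure_mono fun w (hw : 1 < ‖w‖) => ?_).trans_lt (h.trans_lt hνt)
  change 1 ≤ ENNReal.ofReal (min 1 (‖w‖ ^ 2))
  rw [min_eq_left (one_le_pow₀ hw.le), ENNReal.ofReal_one]

lemma measurableSet_one_lt_norm : MeasurableSet {w : EuclideanSpace ℝ (Fin d) | 1 < ‖w‖} :=
  measurableSet_lt measurable_const measurable_norm

lemma tendsto_integral_setIntegral_lkJump_div
    (hνt : ∫⁻ u, ENNReal.ofReal (min 1 (‖u‖ ^ 2)) ∂νt < ∞) (ξ : EuclideanSpace ℝ (Fin d)) :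
    Tendsto (fun t : ℝ =>
        (∫ u, (∫ v in Ioi (0 : ℝ), lkJump (Real.exp (-t)) ξ (Real.exp (-v) • u)) ∂νt) / (t : ℂ))
      (𝓝[>] 0) (𝓝 (∫ u in {w | 1 < ‖w‖}, Complex.I * ((⟪ξ, ‖u‖⁻¹ • u⟫ : ℝ) : ℂ) ∂νt)) := by
  refine Tendsto.congr (fun t : ℝ => integral_div (μ := νt) (t : ℂ)
    fun u => ∫ v in Ioi (0 : ℝ), lkJump (Real.exp (-t)) ξ (Real.exp (-v) • u)) ?_
  rw [← integral_indicator measurableSet_one_lt_norm]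
  refine tendsto_integral_filter_of_dominated_convergence
    ({w : EuclideanSpace ℝ (Fin d) | 1 < ‖w‖}.indicator fun _ => ‖ξ‖)
    (Eventually.of_forall fun t => ?_) (eventually_mem_nhdsWithin.mono fun t (ht : 0 < t) =>
      Eventually.of_forall fun u => ?_) ?_ (Eventually.of_forall fun u => ?_)
  · simp_rw [div_eq_mul_inv]
    have hm : Measurable fun p : EuclideanSpace ℝ (Fin d) × ℝ =>
        lkJump (Real.exp (-t)) ξ (Real.exp (-p.2) • p.1) :=
      (measurable_lkJump _ ξ).comp (by fun_prop)
    exact (hm.stronglyMeasurable.integral_prod_right'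
      (ν := volume.restrict (Ioi 0))).aestronglyMeasurable.mul_const _
  · rw [norm_div, Complex.norm_real, Real.norm_of_nonneg ht.le, div_le_iff₀ ht]
    refine (norm_setIntegral_lkJump_le ξ u ht.le).trans_eq ?_
    by_cases hu : u ∈ {w : EuclideanSpace ℝ (Fin d) | 1 < ‖w‖} <;> simp [hu, mul_comm]
  · exact (integrable_indicator_iff measurableSet_one_lt_norm).2
      (integrableOn_const (measure_one_lt_norm_lt_top hνt).ne)
  · rcases le_or_gt ‖u‖ 1 with hu | hu
    · simp_rw [setIntegral_lkJump_eq_zero hu]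
      simp [hu.not_gt]
    · rw [indicator_of_mem (show u ∈ {w : EuclideanSpace ℝ (Fin d) | 1 < ‖w‖} from hu)]
      have hlog : 0 < Real.log ‖u‖ := Real.log_pos hu
      have h := ((Complex.continuous_ofReal.tendsto 1).comp
        tendsto_one_sub_exp_neg_div).mul_const (Complex.I * ((⟪ξ, ‖u‖⁻¹ • u⟫ : ℝ) : ℂ))
      simp only [Complex.ofReal_one, one_mul] at h
      refine h.congr' ?_
      filter_upwards [Ioc_mem_nhdsGT hlog] with t ht
      rw [setIntegral_lkJump_eq_of_le hu ht.1.le ht.2, Function.comp_apply]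
      push_cast
      ring

end

section

variable {d : ℕ} {σ νt : Measure (EuclideanSpace ℝ (Fin d))}
  {τ : EuclideanSpace ℝ (Fin d) → Measure ℝ} {k : EuclideanSpace ℝ (Fin d) → ℝ → ℝ}

lemma setOf_norm_eq_one : {x : EuclideanSpace ℝ (Fin d) | ‖x‖ = 1} = Metric.sphere 0 1 := by
  ext x
  exact (mem_sphere_zero_iff_norm).symm

lemma aemeasurable_of_continuousOn_sphere {β : Type*} [MeasurableSpace β] [TopologicalSpace β]
    [BorelSpace β] {f : EuclideanSpace ℝ (Fin d) → β} (hσ : ∀ᵐ x ∂σ, ‖x‖ = 1)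
    (hf : ContinuousOn f {x | ‖x‖ = 1}) : AEMeasurable f σ := by
  rw [← Measure.restrict_eq_self_of_ae_mem (μ := σ) (s := {x | ‖x‖ = 1}) hσ]
  exact hf.aemeasurable (measurableSet_eq_fun measurable_norm measurable_const)

lemma integrable_of_continuousOn_sphere [IsFiniteMeasure σ] {F : Type*} [NormedAddCommGroup F]
    {f : EuclideanSpace ℝ (Fin d) → F} (hσ : ∀ᵐ x ∂σ, ‖x‖ = 1)
    (hf : ContinuousOn f {x | ‖x‖ = 1}) : Integrable f σ := by
  rw [← Measure.restrict_eq_self_of_ae_mem (μ := σ) (s := {x | ‖x‖ = 1}) hσ]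
  rw [setOf_norm_eq_one] at hf ⊢
  exact hf.integrableOn_compact (isCompact_sphere _ _)

lemma measure_singleton_zero_of_polar (hσ : ∀ᵐ x ∂σ, ‖x‖ = 1) (hτ0 : ∀ x, τ x (Iic 0) = 0)
    (hνt : ∀ g : EuclideanSpace ℝ (Fin d) → ℝ≥0∞, Measurable g →
      ∫⁻ u, g u ∂νt = ∫⁻ x, (∫⁻ r, g (r • x) ∂(τ x)) ∂σ) : νt {0} = 0 := by
  rw [← lintegral_indicator_one (measurableSet_singleton 0),
    hνt _ (measurable_one.indicator (measurableSet_singleton 0)), ← lintegral_zero (μ := σ)]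
  refine lintegral_congr_ae (hσ.mono fun y hy => ?_)
  simp only
  rw [← lintegral_zero (μ := τ y)]
  have : ∀ᵐ r ∂τ y, r ∉ Iic (0 : ℝ) := measure_eq_zero_iff_ae_notMem.1 (hτ0 y)
  refine lintegral_congr_ae (this.mono fun r hr => ?_)
  have hr : 0 < r := not_le.1 hr
  have hy0 : y ≠ 0 := norm_ne_zero_iff.1 (by rw [hy]; exact one_ne_zero)
  simp [hr.ne', hy0]

lemma setLIntegral_one_lt_norm_of_polar (hσ : ∀ᵐ x ∂σ, ‖x‖ = 1) (hτ0 : ∀ x, τ x (Iic 0) = 0)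
    (hτ1 : ∀ᵐ x ∂σ, τ x (Ioi 1) = ENNReal.ofReal (k x 1))
    (hνt : ∀ g : EuclideanSpace ℝ (Fin d) → ℝ≥0∞, Measurable g →
      ∫⁻ u, g u ∂νt = ∫⁻ x, (∫⁻ r, g (r • x) ∂(τ x)) ∂σ)
    {h : EuclideanSpace ℝ (Fin d) → ℝ≥0∞} (hh : Measurable h) :
    ∫⁻ u in {w | 1 < ‖w‖}, h (‖u‖⁻¹ • u) ∂νt = ∫⁻ y, ENNReal.ofReal (k y 1) * h y ∂σ := by
  rw [← lintegral_indicator measurableSet_one_lt_norm,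
    hνt _ (Measurable.indicator (by fun_prop) measurableSet_one_lt_norm)]
  refine lintegral_congr_ae ?_
  filter_upwards [hσ, hτ1] with y hy hy1
  have : ∀ᵐ r ∂τ y, r ∉ Iic (0 : ℝ) := measure_eq_zero_iff_ae_notMem.1 (hτ0 y)
  rw [mul_comm, ← hy1, ← lintegral_indicator_const measurableSet_Ioi]
  refine lintegral_congr_ae (this.mono fun r hr => ?_)
  have hr : 0 < r := not_le.1 hr
  have hn : ‖r • y‖ = r := by rw [norm_smul, hy, mul_one, Real.norm_of_nonneg hr.le]
  by_cases h1 : 1 < r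
  · simp only
    rw [indicator_of_mem (show r • y ∈ {w : EuclideanSpace ℝ (Fin d) | 1 < ‖w‖} from
      h1.trans_eq hn.symm), indicator_of_mem (show r ∈ Ioi (1 : ℝ) from h1), hn, smul_smul,
      inv_mul_cancel₀ hr.ne', one_smul]
  · simp only
    rw [indicator_of_notMem (show r • y ∉ {w : EuclideanSpace ℝ (Fin d) | 1 < ‖w‖} from
      fun h' => h1 (lt_of_lt_of_eq h' hn)), indicator_of_notMem (show r ∉ Ioi (1 : ℝ) from h1)]

lemma setIntegral_one_lt_norm_of_polar [IsFiniteMeasure σ] (hσ : ∀ᵐ x ∂σ, ‖x‖ = 1)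
    (hτ0 : ∀ x, τ x (Iic 0) = 0) (hk1 : ∀ x, 0 ≤ k x 1)
    (hkc : ContinuousOn (fun x => k x 1) {x : EuclideanSpace ℝ (Fin d) | ‖x‖ = 1})
    (hτ1 : ∀ᵐ x ∂σ, τ x (Ioi 1) = ENNReal.ofReal (k x 1))
    (hνt : ∀ g : EuclideanSpace ℝ (Fin d) → ℝ≥0∞, Measurable g →
      ∫⁻ u, g u ∂νt = ∫⁻ x, (∫⁻ r, g (r • x) ∂(τ x)) ∂σ)
    (ξ : EuclideanSpace ℝ (Fin d)) :
    ∫ u in {w | 1 < ‖w‖}, Complex.I * ((⟪ξ, ‖u‖⁻¹ • u⟫ : ℝ) : ℂ) ∂νt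
      = Complex.I * ((⟪∫ y, k y 1 • y ∂σ, ξ⟫ : ℝ) : ℂ) := by
  have hkm : AEMeasurable (fun y => ENNReal.ofReal (k y 1)) σ :=
    (aemeasurable_of_continuousOn_sphere hσ hkc).ennreal_ofReal
  have hf : Measurable fun u : EuclideanSpace ℝ (Fin d) => ‖u‖⁻¹ • u := by fun_prop
  have hmap : (νt.restrict {w | 1 < ‖w‖}).map (fun u => ‖u‖⁻¹ • u)
      = σ.withDensity fun y => ENNReal.ofReal (k y 1) := by
    refine Measure.ext_of_lintegral _ fun h hh => ?_
    rw [lintegral_map hh hf, setLIntegral_one_lt_norm_of_polar hσ hτ0 hτ1 hνt hh,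
      lintegral_withDensity_eq_lintegral_mul₀ hkm hh.aemeasurable]
    rfl
  rw [integral_const_mul, integral_complex_ofReal]
  congr 2
  rw [← integral_map (f := fun y => ⟪ξ, y⟫) hf.aemeasurable (by fun_prop), hmap,
    integral_withDensity_eq_integral_toReal_smul₀ hkm (by simp), real_inner_comm, ← integral_inner]
  · simp_rw [ENNReal.toReal_ofReal (hk1 _), real_inner_smul_right, smul_eq_mul]
  · exact integrable_of_continuousOn_sphere hσ (hkc.smul continuousOn_id)

lemma measureReal_one_lt_norm_of_polar [IsFiniteMeasure σ] (hσ : ∀ᵐ x ∂σ, ‖x‖ = 1)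
    (hτ0 : ∀ x, τ x (Iic 0) = 0) (hk1 : ∀ x, 0 ≤ k x 1)
    (hkc : ContinuousOn (fun x => k x 1) {x : EuclideanSpace ℝ (Fin d) | ‖x‖ = 1})
    (hτ1 : ∀ᵐ x ∂σ, τ x (Ioi 1) = ENNReal.ofReal (k x 1))
    (hνt : ∀ g : EuclideanSpace ℝ (Fin d) → ℝ≥0∞, Measurable g →
      ∫⁻ u, g u ∂νt = ∫⁻ x, (∫⁻ r, g (r • x) ∂(τ x)) ∂σ) :
    νt.real {w | 1 < ‖w‖} = ∫ y, k y 1 ∂σ := by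
  have h := setLIntegral_one_lt_norm_of_polar hσ hτ0 hτ1 hνt (h := fun _ => 1) measurable_const
  simp only [lintegral_const, Measure.restrict_apply_univ, one_mul, mul_one] at h
  rw [Measure.real, h, integral_eq_lintegral_of_nonneg_ae (Eventually.of_forall hk1)
    (aemeasurable_of_continuousOn_sphere hσ hkc).aestronglyMeasurable]

lemma setLIntegral_Ioc_sq_eq {μ : Measure ℝ} {f : ℝ → ℝ} (hf : AntitoneOn f (Ioi 0))
    (hμ : ∀ a c : ℝ, 0 < a → a ≤ c → μ (Ioc a c) = ENNReal.ofReal (f a - f c)) :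
    ∫⁻ s in Ioc (0 : ℝ) 1, ENNReal.ofReal (s ^ 2) ∂μ
      = 2 * ∫⁻ r in Ioi (0 : ℝ), ENNReal.ofReal (f r - f 1) * ENNReal.ofReal r := by
  have h := lintegral_rpow_eq_lintegral_meas_lt_mul (μ.restrict (Ioc 0 1)) (f := fun s : ℝ => s)
    ((ae_restrict_mem measurableSet_Ioc).mono fun s hs => hs.1.le) (by fun_prop)
    (p := 2) two_pos
  simp only [Real.rpow_two, ENNReal.ofReal_ofNat] at h
  rw [h]
  congr 1
  refine setLIntegral_congr_fun measurableSet_Ioi fun r (hr : 0 < r) => ?_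
  have h1 : {s : ℝ | r < s} ∩ Ioc 0 1 = Ioc r 1 := by
    ext s
    simp only [mem_inter_iff, mem_ofPred_eq, mem_Ioc]
    exact ⟨fun h => ⟨h.1, h.2.2⟩, fun h => ⟨h.1, hr.trans h.1, h.2⟩⟩
  norm_num
  rw [h1]
  congr 1
  rcases le_or_gt r 1 with hr1 | hr1
  · exact hμ r 1 hr hr1
  · rw [Ioc_eq_empty hr1.not_gt, measure_empty, ENNReal.ofReal_of_nonpos]
    exact sub_nonpos.2 (hf (mem_Ioi.2 one_pos) hr hr1.le)

lemma aemeasurable_setLIntegral_Ioc_sq (hσ : ∀ᵐ x ∂σ, ‖x‖ = 1)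
    (hkcr : ∀ x, ContinuousOn (k x) (Ioi 0)) (hkmono : ∀ x, AntitoneOn (k x) (Ioi 0))
    (hkcx : ∀ r : ℝ, 0 < r →
      ContinuousOn (fun x => k x r) {x : EuclideanSpace ℝ (Fin d) | ‖x‖ = 1})
    (hτ : ∀ x : EuclideanSpace ℝ (Fin d), ∀ a c : ℝ, 0 < a → a ≤ c →
      τ x (Ioc a c) = ENNReal.ofReal (k x a - k x c)) :
    AEMeasurable (fun y => ∫⁻ s in Ioc (0 : ℝ) 1, ENNReal.ofReal (s ^ 2) ∂(τ y)) σ := by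
  have hS : MeasurableSet {x : EuclideanSpace ℝ (Fin d) | ‖x‖ = 1} :=
    measurableSet_eq_fun measurable_norm measurable_const
  simp_rw [fun y => setLIntegral_Ioc_sq_eq (hkmono y) (hτ y)]
  rw [← Measure.restrict_eq_self_of_ae_mem (μ := σ) (s := {x | ‖x‖ = 1}) hσ,
    ← map_comap_subtype_coe hS, (MeasurableEmbedding.subtype_coe hS).aemeasurable_map_iff]
  simp_rw [← lintegral_subtype_comap (μ := volume) (measurableSet_Ioi (a := (0 : ℝ)))]
  refine Measurable.aemeasurable (Measurable.const_mul ?_ _)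
  have hk : Measurable (Function.uncurry fun (y : {x : EuclideanSpace ℝ (Fin d) | ‖x‖ = 1})
      (r : Ioi (0 : ℝ)) => k y r) :=
    measurable_uncurry_of_continuous_of_measurable
      (fun r => continuousOn_iff_continuous_domRestrict.1 (hkcx r r.2))
      fun y => (continuousOn_iff_continuous_domRestrict.1 (hkcr y)).measurable
  have hk1 : Measurable fun y : {x : EuclideanSpace ℝ (Fin d) | ‖x‖ = 1} => k y 1 :=
    (continuousOn_iff_continuous_domRestrict.1 (hkcx 1 one_pos)).measurable
  have : SigmaFinite ((volume : Measure ℝ).comap ((↑) : Ioi (0 : ℝ) → ℝ)) :=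
    SigmaFinite.of_map _ measurable_subtype_coe.aemeasurable
      (by rw [map_comap_subtype_coe measurableSet_Ioi]; infer_instance)
  refine Measurable.lintegral_prod_right' (f := fun p : {x : EuclideanSpace ℝ (Fin d) | ‖x‖ = 1}
    × Ioi (0 : ℝ) => ENNReal.ofReal (k p.1 p.2 - k p.1 1) * ENNReal.ofReal (p.2 : ℝ)) ?_
  exact (hk.sub (hk1.comp measurable_fst)).ennreal_ofReal.mul (by fun_prop)

lemma integral_lkBound_of_polar [IsFiniteMeasure σ] (hσ : ∀ᵐ x ∂σ, ‖x‖ = 1)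
    (hτ0 : ∀ x, τ x (Iic 0) = 0)
    (hνt : ∀ g : EuclideanSpace ℝ (Fin d) → ℝ≥0∞, Measurable g →
      ∫⁻ u, g u ∂νt = ∫⁻ x, (∫⁻ r, g (r • x) ∂(τ x)) ∂σ)
    (hfin : ∫⁻ u, ENNReal.ofReal (min 1 (‖u‖ ^ 2)) ∂νt < ∞)
    (hmeas : AEMeasurable (fun y => ∫⁻ s in Ioc (0 : ℝ) 1, ENNReal.ofReal (s ^ 2) ∂(τ y)) σ)
    (ξ : EuclideanSpace ℝ (Fin d)) :
    ∫ u, lkBound ξ u ∂νt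
      = ‖ξ‖ ^ 2 * ∫ y, (∫⁻ s in Ioc (0 : ℝ) 1, ENNReal.ofReal (s ^ 2) ∂(τ y)).toReal ∂σ
        + (2 + ‖ξ‖ ^ 2) * νt.real {w | 1 < ‖w‖} := by
  have hS : MeasurableSet {w : EuclideanSpace ℝ (Fin d) | ‖w‖ ≤ 1} :=
    measurableSet_le measurable_norm measurable_const
  have hcompl : {w : EuclideanSpace ℝ (Fin d) | ‖w‖ ≤ 1}ᶜ = {w | 1 < ‖w‖} := by
    ext w; simp
  have hpol : ∫⁻ u in {w : EuclideanSpace ℝ (Fin d) | ‖w‖ ≤ 1}, ENNReal.ofReal (‖u‖ ^ 2) ∂νt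
      = ∫⁻ y, (∫⁻ s in Ioc (0 : ℝ) 1, ENNReal.ofReal (s ^ 2) ∂(τ y)) ∂σ := by
    rw [← lintegral_indicator hS, hνt _ (Measurable.indicator (by fun_prop) hS)]
    refine lintegral_congr_ae (hσ.mono fun y hy => ?_)
    have : ∀ᵐ r ∂τ y, r ∉ Iic (0 : ℝ) := measure_eq_zero_iff_ae_notMem.1 (hτ0 y)
    simp only
    rw [← lintegral_indicator measurableSet_Ioc]
    refine lintegral_congr_ae (this.mono fun r hr => ?_)
    have hr : 0 < r := not_le.1 hr
    have hn : ‖r • y‖ = r := by rw [norm_smul, hy, mul_one, Real.norm_of_nonneg hr.le]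
    by_cases h1 : r ≤ 1
    · simp only
      rw [indicator_of_mem (show r • y ∈ {w : EuclideanSpace ℝ (Fin d) | ‖w‖ ≤ 1} from
        hn.trans_le h1), indicator_of_mem (show r ∈ Ioc (0 : ℝ) 1 from ⟨hr, h1⟩), hn]
    · simp only
      rw [indicator_of_notMem (show r • y ∉ {w : EuclideanSpace ℝ (Fin d) | ‖w‖ ≤ 1} from
        fun h' => h1 (hn.ge.trans h')), indicator_of_notMem (fun h' : r ∈ Ioc (0 : ℝ) 1 => h1 h'.2)]
  have hlt : ∫⁻ y, (∫⁻ s in Ioc (0 : ℝ) 1, ENNReal.ofReal (s ^ 2) ∂(τ y)) ∂σ < ∞ := by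
    rw [← hpol]
    refine ((setLIntegral_mono' hS fun u (hu : ‖u‖ ≤ 1) => ?_).trans
      (setLIntegral_le_lintegral _ _)).trans_lt hfin
    rw [min_eq_right (pow_le_one₀ (norm_nonneg _) hu)]
  have h1 : ∫ u in {w : EuclideanSpace ℝ (Fin d) | ‖w‖ ≤ 1}, ‖u‖ ^ 2 ∂νt
      = ∫ y, (∫⁻ s in Ioc (0 : ℝ) 1, ENNReal.ofReal (s ^ 2) ∂(τ y)).toReal ∂σ := by
    rw [integral_toReal hmeas (ae_lt_top' hmeas hlt.ne), ← hpol,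
      integral_eq_lintegral_of_nonneg_ae (Eventually.of_forall fun _ => by positivity)
        (by fun_prop)]
  rw [← integral_add_compl hS (integrable_lkBound hfin ξ), hcompl, ← h1, ← integral_const_mul,
    setIntegral_congr_fun (f := lkBound ξ) hS (g := fun u => ‖ξ‖ ^ 2 * ‖u‖ ^ 2) fun u hu => if_pos hu,
    setIntegral_congr_fun (f := lkBound ξ) measurableSet_one_lt_norm (g := fun _ => 2 + ‖ξ‖ ^ 2)
      fun u (hu : 1 < ‖u‖) => if_neg hu.not_ge, setIntegral_const, smul_eq_mul,
    mul_comm (νt.real _)]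

end

lemma re_integral_nonneg {α : Type*} [MeasurableSpace α] {μ : Measure α} {f : α → ℂ}
    (hf : ∀ x, 0 ≤ (f x).re) : 0 ≤ (∫ x, f x ∂μ).re := by
  by_cases h : Integrable f μ
  · rw [← RCLike.re_to_complex, ← integral_re h]
    exact integral_nonneg hf
  · rw [integral_undef h, Complex.zero_re]

lemma re_integral_nonpos {α : Type*} [MeasurableSpace α] {μ : Measure α} {f : α → ℂ}
    (hf : ∀ x, (f x).re ≤ 0) : (∫ x, f x ∂μ).re ≤ 0 := by
  have h := re_integral_nonneg (μ := μ) (f := fun x => -f x) fun x => by simpa using hf x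
  rwa [integral_neg, Complex.neg_re, neg_nonneg] at h

section

variable {d : ℕ} {ν νt : Measure (EuclideanSpace ℝ (Fin d))}

lemma norm_integral_setIntegral_lkKernel_le
    (hνt : ∫⁻ u, ENNReal.ofReal (min 1 (‖u‖ ^ 2)) ∂νt < ∞) (ξ : EuclideanSpace ℝ (Fin d))
    {t : ℝ} (ht : 0 ≤ t) :
    ‖∫ u, (∫ v in Ioc 0 t, lkKernel ξ (Real.exp (-v) • u)) ∂νt‖ ≤ t * ∫ u, lkBound ξ u ∂νt := by
  rw [← integral_const_mul]
  exact norm_integral_le_of_norm_le ((integrable_lkBound hνt ξ).const_mul t)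
    (Eventually.of_forall fun u => norm_setIntegral_lkKernel_le ξ u ht)

lemma norm_integral_setIntegral_lkJump_le
    (hνt : ∫⁻ u, ENNReal.ofReal (min 1 (‖u‖ ^ 2)) ∂νt < ∞) (ξ : EuclideanSpace ℝ (Fin d))
    {t : ℝ} (ht : 0 ≤ t) :
    ‖∫ u, (∫ v in Ioi (0 : ℝ), lkJump (Real.exp (-t)) ξ (Real.exp (-v) • u)) ∂νt‖
      ≤ t * (‖ξ‖ * νt.real {w | 1 < ‖w‖}) := by
  refine (norm_integral_le_of_norm_le ((integrable_indicator_iff measurableSet_one_lt_norm).2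
    (integrableOn_const (measure_one_lt_norm_lt_top hνt).ne))
    (Eventually.of_forall fun u => norm_setIntegral_lkJump_le ξ u ht)).trans_eq ?_
  rw [integral_indicator measurableSet_one_lt_norm, setIntegral_const, smul_eq_mul]
  ring

lemma re_integral_setIntegral_lkKernel_nonpos (ξ : EuclideanSpace ℝ (Fin d)) (t : ℝ) :
    (∫ u, (∫ v in Ioc 0 t, lkKernel ξ (Real.exp (-v) • u)) ∂νt).re ≤ 0 :=
  re_integral_nonpos fun u => re_integral_nonpos fun v => by
    rw [re_lkKernel]; linarith [Real.cos_le_one ⟪ξ, Real.exp (-v) • u⟫]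

lemma re_integral_setIntegral_lkJump_nonneg (ξ : EuclideanSpace ℝ (Fin d)) (t : ℝ) :
    0 ≤ (∫ u, (∫ v in Ioi (0 : ℝ),
      lkJump (Real.exp (-t)) ξ (Real.exp (-v) • u)) ∂νt).re :=
  re_integral_nonneg fun u => re_integral_nonneg fun v => by
    unfold lkJump; split_ifs <;> simp

lemma exp_mul_phiLK_div (b ξ x : EuclideanSpace ℝ (Fin d)) (c : ℝ) :
    Complex.exp (Complex.I * (((c - 1) * ⟪x, ξ⟫ : ℝ) : ℂ)) * phiLK b ν ξ / phiLK b ν (c • ξ)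
      = Complex.exp (Complex.I * (((1 - c) * ⟪b - x, ξ⟫ : ℝ) : ℂ)
        + (∫ u, lkKernel ξ u ∂ν - ∫ u, lkKernel (c • ξ) u ∂ν)) := by
  rw [phiLK_eq, phiLK_eq, ← Complex.exp_add, ← Complex.exp_sub, inner_sub_left,
    real_inner_smul_right]
  congr 1
  push_cast
  ring

end

/-- Pointwise limit and uniform-in-`t` bound for the approximate generator symbol
(`lem:GenCau`). -/
theorem stmt18 {d : ℕ}
    (μX : Measure (EuclideanSpace ℝ (Fin d))) [IsProbabilityMeasure μX]
    (ν νt : Measure (EuclideanSpace ℝ (Fin d)))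
    (σ : Measure (EuclideanSpace ℝ (Fin d))) [IsFiniteMeasure σ]
    (τ : EuclideanSpace ℝ (Fin d) → Measure ℝ)
    (b : EuclideanSpace ℝ (Fin d))
    (k : EuclideanSpace ℝ (Fin d) → ℝ → ℝ)
    (hnondeg : ∀ (v : EuclideanSpace ℝ (Fin d)) (c : ℝ), v ≠ 0 →
      μX {x : EuclideanSpace ℝ (Fin d) | ⟪v, x⟫ = c} ≠ 1)
    (hσ : σ {x : EuclideanSpace ℝ (Fin d) | ¬ ‖x‖ = 1} = 0)
    (hk0 : ∀ x, ∀ r : ℝ, 0 < r → 0 ≤ k x r)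
    (hkcr : ∀ x, ContinuousOn (k x) (Ioi 0))
    (hkmono : ∀ x, AntitoneOn (k x) (Ioi 0))
    (hkcx : ∀ r : ℝ, 0 < r →
      ContinuousOn (fun x => k x r) {x : EuclideanSpace ℝ (Fin d) | ‖x‖ = 1})
    (hklim0 : ∀ x, ‖x‖ = 1 → Tendsto (fun r => r ^ 2 * k x r) (𝓝[>] 0) (𝓝 0))
    (hkliminfty : ∀ x, ‖x‖ = 1 → Tendsto (k x) atTop (𝓝 0))
    (hpolar : ∀ g : EuclideanSpace ℝ (Fin d) → ℝ≥0∞, Measurable g →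
      ∫⁻ u, g u ∂ν
        = ∫⁻ x, (∫⁻ r in Ioi (0 : ℝ), g (r • x) * ENNReal.ofReal (k x r / r)) ∂σ)
    (hτ : ∀ x : EuclideanSpace ℝ (Fin d),
      (∀ a c : ℝ, 0 < a → a ≤ c → τ x (Ioc a c) = ENNReal.ofReal (k x a - k x c))
        ∧ τ x (Iic 0) = 0)
    (hνt : ∀ g : EuclideanSpace ℝ (Fin d) → ℝ≥0∞, Measurable g →
      ∫⁻ u, g u ∂νt = ∫⁻ x, (∫⁻ r, g (r • x) ∂(τ x)) ∂σ)
    (hchar : ∀ ξ, charFn μX ξ = phiLK b ν ξ) :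
    ∀ ξ x : EuclideanSpace ℝ (Fin d),
      -- (i) pointwise limit of the approximate generator symbol
      Tendsto (fun t : ℝ =>
          (Complex.exp (Complex.I * (((Real.exp (-t) - 1) * ⟪x, ξ⟫ : ℝ) : ℂ))
              * phiLK b ν ξ / phiLK b ν (Real.exp (-t) • ξ) - 1) / (t : ℂ))
        (𝓝[>] 0)
        (𝓝 (Complex.I * ((⟪b - (∫ y, k y 1 • y ∂σ) - x, ξ⟫ : ℝ) : ℂ)
          + ∫ u, (Complex.exp (Complex.I * ((⟪u, ξ⟫ : ℝ) : ℂ)) - 1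
              - (if ‖u‖ ≤ 1 then Complex.I * ((⟪u, ξ⟫ : ℝ) : ℂ) else 0)) ∂νt))
      ∧
      -- (ii) uniform bound for `t ∈ (0,1)`
      ∀ t ∈ Ioo (0 : ℝ) 1,
        (1 / t) * ‖Complex.exp (Complex.I * (((Real.exp (-t) - 1) * ⟪x, ξ⟫ : ℝ) : ℂ))
            * phiLK b ν ξ / phiLK b ν (Real.exp (-t) • ξ) - 1‖
          ≤ (‖x‖ + ‖b‖) * ‖ξ‖
            + ‖ξ‖ ^ 2 * ∫ y, (∫⁻ s in Ioc (0 : ℝ) 1, ENNReal.ofReal (s ^ 2) ∂(τ y)).toReal ∂σ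
            + 4 * ∫ y, k y 1 ∂σ
            + 2 * ‖ξ‖ ^ 2 * ∫ y, k y 1 ∂σ
            + 2 * ∫ y, (τ y (Ioi 1)).toReal ∂σ
            + ‖ξ‖ * ∫ y, k y 1 ∂σ := by
  intro ξ x
  have hσ' : ∀ᵐ y ∂σ, ‖y‖ = 1 := hσ
  have hτ0 : ∀ y, τ y (Iic 0) = 0 := fun y => (hτ y).2
  have hτr : ∀ᵐ y ∂σ, ∀ r, 0 < r → τ y (Ioi r) = ENNReal.ofReal (k y r) :=
    hσ'.mono fun y hy r hr => measure_Ioi_eq_ofReal_of_tendsto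
      (fun c hc => (hτ y).1 r c hr hc) (hkliminfty y hy)
  have hτ1 : ∀ᵐ y ∂σ, τ y (Ioi 1) = ENNReal.ofReal (k y 1) := hτr.mono fun y hy => hy 1 one_pos
  have hk1 : ∀ y, 0 ≤ k y 1 := fun y => hk0 y 1 one_pos
  have hdis : IsExpDiscount ν νt := isExpDiscount_of_polar hpolar hνt
    (hτr.mono fun y hy => ⟨sigmaFinite_of_Ioc_of_Iic _
      (fun a c ha hac => by rw [(hτ y).1 a c ha hac]; exact ENNReal.ofReal_lt_top) (hτ0 y),
      hτ0 y, hy⟩)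
  have hν := hdis.lintegral_min_one_sq_lt_top
    (hdis.lintegral_one_sub_cos_ne_top hnondeg hchar)
  have hfin := hdis.lintegral_min_one_sq_lt_top' hν
  have : SigmaFinite νt :=
    sigmaFinite_of_lintegral_min_one_sq hfin (measure_singleton_zero_of_polar hσ' hτ0 hνt)
  have hexp : ∀ t : ℝ, 0 < t →
      Complex.exp (Complex.I * (((Real.exp (-t) - 1) * ⟪x, ξ⟫ : ℝ) : ℂ))
        * phiLK b ν ξ / phiLK b ν (Real.exp (-t) • ξ)
      = Complex.exp (Complex.I * (((1 - Real.exp (-t)) * ⟪b - x, ξ⟫ : ℝ) : ℂ)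
        + (∫ u, (∫ v in Ioc 0 t, lkKernel ξ (Real.exp (-v) • u)) ∂νt
          - ∫ u, (∫ v in Ioi (0 : ℝ),
            lkJump (Real.exp (-t)) ξ (Real.exp (-v) • u)) ∂νt)) := fun t ht => by
    rw [exp_mul_phiLK_div, hdis.integral_lkKernel_sub hν ξ ht.le]
  refine ⟨?_, ?_⟩
  · refine Tendsto.congr' (eventually_mem_nhdsWithin.mono fun t (ht : 0 < t) =>
      congrArg (fun z : ℂ => (z - 1) / (t : ℂ)) (hexp t ht).symm)
      (tendsto_exp_mul_sub_one_div ?_)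
    have h1 : Tendsto (fun t : ℝ =>
        Complex.I * (((1 - Real.exp (-t)) * ⟪b - x, ξ⟫ : ℝ) : ℂ) / (t : ℂ)) (𝓝[>] 0)
        (𝓝 (Complex.I * ((⟪b - x, ξ⟫ : ℝ) : ℂ))) := by
      have h := ((Complex.continuous_ofReal.tendsto 1).comp
        tendsto_one_sub_exp_neg_div).mul_const (Complex.I * ((⟪b - x, ξ⟫ : ℝ) : ℂ))
      rw [Complex.ofReal_one, one_mul] at h
      refine h.congr fun t => ?_
      rw [Function.comp_apply]
      push_cast
      ring
    have h2 := h1.add ((tendsto_integral_setIntegral_lkKernel_div hfin ξ).sub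
      (tendsto_integral_setIntegral_lkJump_div hfin ξ))
    rw [setIntegral_one_lt_norm_of_polar hσ' hτ0 hk1 (hkcx 1 one_pos) hτ1 hνt] at h2
    convert h2 using 2
    · rw [add_div, sub_div]
    · simp_rw [inner_sub_left, fun u => real_inner_comm ξ u]
      change _ + ∫ u, lkKernel ξ u ∂νt = _
      push_cast
      ring
  · rintro t ⟨ht, -⟩
    have hm := measureReal_one_lt_norm_of_polar hσ' hτ0 hk1 (hkcx 1 one_pos) hτ1 hνt
    have hτm : ∫ y, (τ y (Ioi 1)).toReal ∂σ = ∫ y, k y 1 ∂σ :=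
      integral_congr_ae (hτ1.mono fun y hy => by
        simp only [hy, ENNReal.toReal_ofReal (hk1 y)])
    have hI : 0 ≤ ∫ y, k y 1 ∂σ := integral_nonneg hk1
    have hB := integral_lkBound_of_polar hσ' hτ0 hνt hfin
      (aemeasurable_setLIntegral_Ioc_sq hσ' hkcr hkmono hkcx fun y => (hτ y).1) ξ
    have hA1 := norm_integral_setIntegral_lkKernel_le hfin ξ ht.le
    have hJ1 := norm_integral_setIntegral_lkJump_le hfin ξ ht.le
    have hdrift : ‖Complex.I * (((1 - Real.exp (-t)) * ⟪b - x, ξ⟫ : ℝ) : ℂ)‖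
        ≤ t * ((‖x‖ + ‖b‖) * ‖ξ‖) := by
      have h0 : 0 ≤ 1 - Real.exp (-t) := sub_nonneg.2 (Real.exp_le_one_iff.2 (by linarith))
      rw [norm_mul, Complex.norm_I, one_mul, Complex.norm_real, norm_mul,
        Real.norm_of_nonneg h0]
      have hle : ‖b - x‖ ≤ ‖x‖ + ‖b‖ := (norm_sub_le b x).trans_eq (add_comm _ _)
      gcongr
      · linarith [Real.add_one_le_exp (-t)]
      · exact (norm_inner_le_norm _ _).trans (by gcongr)
    rw [hexp t ht, hτm, one_div, inv_mul_le_iff₀ ht]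
    refine (norm_exp_sub_one_le_of_re_nonpos ?_).trans ?_
    · have hA := re_integral_setIntegral_lkKernel_nonpos (νt := νt) ξ t
      have hJ := re_integral_setIntegral_lkJump_nonneg (νt := νt) ξ t
      have hI0 (r : ℝ) : (Complex.I * (r : ℂ)).re = 0 := by simp
      rw [Complex.add_re, Complex.sub_re, hI0]
      linarith
    · refine (norm_add_le _ _).trans ((add_le_add hdrift
        ((norm_sub_le _ _).trans (add_le_add hA1 hJ1))).trans ?_)
      rw [← mul_add, ← mul_add, hB, hm]
      refine mul_le_mul_of_nonneg_left ?_ ht.le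
      nlinarith [mul_nonneg (sq_nonneg ‖ξ‖) hI]
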